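/- arXiv:2308.08768 — 4 statements merged into one kernel-verified Lean document; each statement's English description precedes it below -/
import Mathlib

section
/- Let G be a finite simple graph that is both (P3∪P2)-free and W4-free, with ω(G) ≥ 5. If G contains an induced subgraph isomorphic to W5, then χ(G) ≤ 2·ω(G). -/
open SimpleGraph

/-- `P3 ∪ P2`: disjoint union of a path on 3 vertices (0-1-2) and an edge (3-4). -/
def P3P2 : SimpleGraph (Fin 5) :=
  SimpleGraph.fromEdgeSet {s(0,1), s(1,2), s(3,4)}

/-- `W4`: wheel on 5 vertices; 4-cycle 0-1-2-3-0 plus hub 4 adjacent to all. -/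
def W4 : SimpleGraph (Fin 5) :=
  SimpleGraph.fromEdgeSet {s(0,1), s(1,2), s(2,3), s(3,0), s(4,0), s(4,1), s(4,2), s(4,3)}

/-- `W5`: wheel on 6 vertices; 5-cycle 0-1-2-3-4-0 plus hub 5 adjacent to all. -/
def W5 : SimpleGraph (Fin 6) :=
  SimpleGraph.fromEdgeSet {s(0,1), s(1,2), s(2,3), s(3,4), s(4,0),
    s(5,0), s(5,1), s(5,2), s(5,3), s(5,4)}

namespace PW

/-- `(P3 ∪ P2)`-freeness in elementary form. -/
def PFree {V : Type*} (G : SimpleGraph V) : Prop :=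
  ∀ a b c d e : V, G.Adj a b → G.Adj b c → ¬ G.Adj a c → a ≠ c → G.Adj d e →
    ¬ G.Adj a d → ¬ G.Adj a e → ¬ G.Adj b d → ¬ G.Adj b e → ¬ G.Adj c d → ¬ G.Adj c e → False

/-- `W4`-freeness in elementary form: rim `a b c d`, hub `z`. -/
def WFree {V : Type*} (G : SimpleGraph V) : Prop :=
  ∀ a b c d z : V, G.Adj a b → G.Adj b c → G.Adj c d → G.Adj d a → ¬ G.Adj a c → a ≠ c →
    ¬ G.Adj b d → b ≠ d → G.Adj z a → G.Adj z b → G.Adj z c → G.Adj z d → False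

lemma pfree {V : Type*} {G : SimpleGraph V} (hP : IsEmpty (P3P2 ↪g G)) : PFree G := by
  intro a b c d e h1 h2 h3 h4 h5 h6 h7 h8 h9 h10 h11
  refine hP.false ?_
  refine ⟨⟨![a, b, c, d, e], ?_⟩, ?_⟩
  · intro i j hij
    fin_cases i <;> fin_cases j <;> simp at hij ⊢ <;> subst hij <;>
      simp_all [G.adj_comm]
  · intro i j
    change G.Adj (![a, b, c, d, e] i) (![a, b, c, d, e] j) ↔ P3P2.Adj i j
    fin_cases i <;> fin_cases j <;> simp [P3P2] <;> first | assumption | (rw [G.adj_comm]; assumption)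

lemma wfree {V : Type*} {G : SimpleGraph V} (hW : IsEmpty (W4 ↪g G)) : WFree G := by
  intro a b c d z h1 h2 h3 h4 h5 h6 h7 h8 h9 h10 h11 h12
  refine hW.false ?_
  refine ⟨⟨![a, b, c, d, z], ?_⟩, ?_⟩
  · intro i j hij
    fin_cases i <;> fin_cases j <;> simp at hij ⊢ <;> subst hij <;>
      simp_all [G.adj_comm]
  · intro i j
    change G.Adj (![a, b, c, d, z] i) (![a, b, c, d, z] j) ↔ W4.Adj i j
    fin_cases i <;> fin_cases j <;> simp [W4] <;> first | assumption | (rw [G.adj_comm]; assumption)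

/-- `a b c d e` is an induced 5-cycle. -/
structure IsC5 {V : Type*} (G : SimpleGraph V) (a b c d e : V) : Prop where
  ab : G.Adj a b
  bc : G.Adj b c
  cd : G.Adj c d
  de : G.Adj d e
  ea : G.Adj e a
  ac : ¬ G.Adj a c
  bd : ¬ G.Adj b d
  ce : ¬ G.Adj c e
  da : ¬ G.Adj d a
  eb : ¬ G.Adj e b

section
variable {V : Type*} {G : SimpleGraph V} {a b c d e h x y x' y' : V}

lemma IsC5.rot (C : IsC5 G a b c d e) : IsC5 G b c d e a :=
  ⟨C.bc, C.cd, C.de, C.ea, C.ab, C.bd, C.ce, C.da, C.eb, C.ac⟩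

lemma IsC5.rev (C : IsC5 G a b c d e) : IsC5 G a e d c b :=
  ⟨C.ea.symm, C.de.symm, C.cd.symm, C.bc.symm, C.ab.symm, fun t => C.da t.symm,
    fun t => C.ce t.symm, fun t => C.bd t.symm, fun t => C.ac t.symm, fun t => C.eb t.symm⟩

lemma IsC5.ne (C : IsC5 G a b c d e) : a ≠ c ∧ e ≠ b ∧ b ≠ d ∧ c ≠ e ∧ d ≠ a := by
  obtain ⟨h1, h2, h3, h4, h5, h6, h7, h8, h9, h10⟩ := C
  refine ⟨?_, ?_, ?_, ?_, ?_⟩ <;> rintro rfl <;> simp_all [SimpleGraph.adj_comm]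

/-- `h` is adjacent to the whole cycle. -/
def Hub (G : SimpleGraph V) (a b c d e h : V) : Prop :=
  G.Adj h a ∧ G.Adj h b ∧ G.Adj h c ∧ G.Adj h d ∧ G.Adj h e

/-- `x` sees exactly `e, a, b` on the cycle. -/
def TT (G : SimpleGraph V) (a b c d e x : V) : Prop :=
  G.Adj x a ∧ G.Adj x b ∧ ¬ G.Adj x c ∧ ¬ G.Adj x d ∧ G.Adj x e

/-- `x` sees at most `a, b` on the cycle. -/
def Sub2 (G : SimpleGraph V) (c d e x : V) : Prop :=
  ¬ G.Adj x c ∧ ¬ G.Adj x d ∧ ¬ G.Adj x e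

lemma hub_clique (W : WFree G) (C : IsC5 G a b c d e) (hx : Hub G a b c d e x)
    (hy : Hub G a b c d e y) (hne : x ≠ y) : G.Adj x y := by
  by_contra hn
  exact W a x c y b hx.1.symm hx.2.2.1 hy.2.2.1.symm hy.1 C.ac C.ne.1 hn hne
    C.ab.symm hx.2.1.symm C.bc hy.2.1.symm

lemma three_adj (W : WFree G) (C : IsC5 G a b c d e) (hh : Hub G a b c d e h) (hne : x ≠ h)
    (h1 : G.Adj x e) (h2 : G.Adj x a) (h3 : G.Adj x b) : G.Adj x h := by
  by_contra hn
  exact W e x b h a h1.symm h3 hh.2.1.symm hh.2.2.2.2 C.eb C.ne.2.1 hn hne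
    C.ea.symm h2.symm C.ab hh.1.symm

lemma mid_adj (W : WFree G) (C : IsC5 G a b c d e) (hh : Hub G a b c d e h) (hne : x ≠ a)
    (hx : G.Adj x h) (h1 : G.Adj x e) (h3 : G.Adj x b) : G.Adj x a := by
  by_contra hn
  exact W e a b x h C.ea C.ab h3.symm h1 C.eb C.ne.2.1 (fun t => hn t.symm) hne.symm
    hh.2.2.2.2 hh.1 hh.2.1 hx.symm

lemma tt_clique (W : WFree G) (C : IsC5 G a b c d e) (hx : TT G a b c d e x)
    (hy : TT G a b c d e y) (hne : x ≠ y) : G.Adj x y := by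
  by_contra hn
  exact W e x b y a hx.2.2.2.2.symm hx.2.1 hy.2.1.symm hy.2.2.2.2 C.eb C.ne.2.1 hn hne
    C.ea.symm hx.1.symm C.ab hy.1.symm

lemma tt_hub (W : WFree G) (C : IsC5 G a b c d e) (hh : Hub G a b c d e h)
    (hx : TT G a b c d e x) : G.Adj x h := by
  refine three_adj W C hh ?_ hx.2.2.2.2 hx.1 hx.2.1
  rintro rfl
  exact hx.2.2.1 hh.2.2.1

/-- `T_a` is anticomplete to `T_c`. -/
lemma tt_anti (W : WFree G) (C : IsC5 G a b c d e) (hh : Hub G a b c d e h)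
    (hx : TT G a b c d e x) (hy : TT G c d e a b y) : ¬ G.Adj x y := by
  intro hn
  have hxh := tt_hub W C hh hx
  have hyh : G.Adj y h := tt_hub W C.rot.rot ⟨hh.2.2.1, hh.2.2.2.1, hh.2.2.2.2, hh.1, hh.2.1⟩ hy
  refine W x y d e h hn hy.2.1 C.de hx.2.2.2.2.symm hx.2.2.2.1 ?_ hy.2.2.1 ?_
    hxh.symm hyh.symm hh.2.2.2.1 hh.2.2.2.2
  · rintro rfl; exact C.da hx.1
  · rintro rfl; exact C.ce hy.1.symm

/-- There is at most one non-edge between `T_a` and `T_b`. -/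
lemma tt_nonedge (P : PFree G) (W : WFree G) (C : IsC5 G a b c d e) (hh : Hub G a b c d e h)
    (hx : TT G a b c d e x) (hx' : TT G a b c d e x')
    (hy : TT G b c d e a y) (hy' : TT G b c d e a y')
    (hn : ¬ G.Adj x y) (hne : x ≠ x' ∨ y ≠ y') : G.Adj x' y' := by
  have s (u w : V) : ¬ G.Adj u w → ¬ G.Adj w u := fun t t' => t t'.symm
  have hyd : ∀ y, TT G b c d e a y → y ≠ d := by
    rintro y hy rfl; exact C.da hy.2.2.2.2
  have key1 : ∀ x', TT G a b c d e x' → x ≠ x' → G.Adj x' y := by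
    intro x' hx' hxx
    by_contra hn'
    exact P y c d x x' hy.2.1 C.cd hy.2.2.1 (hyd y hy)
      (tt_clique W C hx hx' hxx) (s _ _ hn) (s _ _ hn') (s _ _ hx.2.2.1) (s _ _ hx'.2.2.1)
      (s _ _ hx.2.2.2.1) (s _ _ hx'.2.2.2.1)
  have key2 : ∀ y', TT G b c d e a y' → y ≠ y' → G.Adj x y' := by
    intro y' hy' hyy
    by_contra hn'
    refine P x e d y y' hx.2.2.2.2 C.de.symm hx.2.2.2.1 ?_
      (tt_clique W C.rot hy hy' hyy) hn hn' (s _ _ hy.2.2.2.1) (s _ _ hy'.2.2.2.1)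
      (s _ _ hy.2.2.1) (s _ _ hy'.2.2.1)
    rintro rfl; exact C.da hx.1
  by_cases hxx : x = x'
  · subst hxx
    exact key2 y' hy' (by tauto)
  by_cases hyy : y = y'
  · subst hyy
    exact key1 x' hx' hxx
  by_contra hn'
  have hub' : Hub G b c d e a h := ⟨hh.2.1, hh.2.2.1, hh.2.2.2.1, hh.2.2.2.2, hh.1⟩
  refine W x x' y y' h (tt_clique W C hx hx' hxx) (key1 x' hx' hxx)
    (tt_clique W C.rot hy hy' hyy) (key2 y' hy' hyy).symm hn ?_ hn' ?_
    (tt_hub W C hh hx).symm (tt_hub W C hh hx').symm (tt_hub W C.rot hub' hy).symm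
    (tt_hub W C.rot hub' hy').symm
  · rintro rfl; exact hy.2.2.2.1 hx.2.2.2.2
  · rintro rfl; exact hy'.2.2.2.1 hx'.2.2.2.2

/-- Vertices seeing at most `a, b` on the cycle form a stable set. -/
lemma sub2_stable (P : PFree G) (C : IsC5 G a b c d e) (hx : Sub2 G c d e x)
    (hy : Sub2 G c d e y) : ¬ G.Adj x y := by
  intro hn
  exact P c d e x y C.cd C.de C.ce C.ne.2.2.2.1 hn (fun t => hx.1 t.symm) (fun t => hy.1 t.symm)
    (fun t => hx.2.1 t.symm) (fun t => hy.2.1 t.symm) (fun t => hx.2.2 t.symm)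
    (fun t => hy.2.2 t.symm)

lemma sub2_unique (P : PFree G) (C : IsC5 G a b c d e) (hx : Sub2 G c d e x)
    (hy : Sub2 G c d e y) (hxa : G.Adj x a) (hya : G.Adj y a) : x = y := by
  by_contra hne
  exact P x a y c d hxa hya.symm (sub2_stable P C hx hy) hne C.cd hx.1 hx.2.1 C.ac
    (fun t => C.da t.symm) hy.1 hy.2.1

/-- `E_a` is incompatible with any other vertex of `N(h)` seeing `c` but none of `e, a, b`. -/
lemma edge_conf (P : PFree G) (W : WFree G) (C : IsC5 G a b c d e) (hh : Hub G a b c d e h)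
    (hxh : G.Adj x h) (hyh : G.Adj y h)
    (hx : Sub2 G c d e x) (hxa : G.Adj x a) (hxb : G.Adj x b)
    (hyc : G.Adj y c) (hy : Sub2 G e a b y) : False := by
  by_cases hn : G.Adj x y
  · refine W x y c b h hn hyc C.bc.symm hxb.symm hx.1 ?_ hy.2.2 ?_
      hxh.symm hyh.symm hh.2.2.1 hh.2.1
    · rintro rfl; exact C.ac hxa.symm
    · rintro rfl; exact hy.2.1 C.ab.symm
  · refine P x a e y c hxa C.ea.symm hx.2.2 ?_ hyc hn hx.1 (fun t => hy.2.1 t.symm) C.ac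
      (fun t => hy.1 t.symm) (fun t => C.ce t.symm)
    rintro rfl; exact C.eb hxb

/-- `T_a` is incompatible with `S_c`. -/
lemma tt_conf (P : PFree G) (W : WFree G) (C : IsC5 G a b c d e) (hh : Hub G a b c d e h)
    (hyh : G.Adj y h) (hx : TT G a b c d e x)
    (hyc : G.Adj y c) (hyd : ¬ G.Adj y d) (hy : Sub2 G e a b y) : False := by
  have hxh := tt_hub W C hh hx
  have hyd' : y ≠ d := by rintro rfl; exact hy.1 C.de
  by_cases hn : G.Adj x y
  · refine W x y c b h hn hyc C.bc.symm hx.2.1.symm hx.2.2.1 ?_ hy.2.2 ?_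
      hxh.symm hyh.symm hh.2.2.1 hh.2.1
    · rintro rfl; exact C.ac hx.1.symm
    · rintro rfl; exact hy.2.1 C.ab.symm
  · exact P y c d x a hyc C.cd hyd hyd' hx.1 (fun t => hn t.symm) hy.2.1
      (fun t => hx.2.2.1 t.symm) (fun t => C.ac t.symm) (fun t => hx.2.2.2.1 t.symm) C.da

/-- `T_a` is anticomplete to `E_c`. -/
lemma tt_edge_anti (W : WFree G) (C : IsC5 G a b c d e) (hh : Hub G a b c d e h)
    (hyh : G.Adj y h) (hx : TT G a b c d e x)
    (hyc : G.Adj y c) (hy : Sub2 G e a b y) : ¬ G.Adj x y := by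
  intro hn
  have hxh := tt_hub W C hh hx
  refine W x y c b h hn hyc C.bc.symm hx.2.1.symm hx.2.2.1 ?_ hy.2.2 ?_
      hxh.symm hyh.symm hh.2.2.1 hh.2.1
  · rintro rfl; exact C.ac hx.1.symm
  · rintro rfl; exact hy.2.1 C.ab.symm

end

/-! Partial colourings -/

section
variable {V : Type*} {G : SimpleGraph V}

/-- The vertices in `s` can be properly coloured with `n` colours. -/
def Col (G : SimpleGraph V) (s : Set V) (n : ℕ) : Prop :=
  ∃ f : V → ℕ, (∀ x ∈ s, f x < n) ∧ ∀ x ∈ s, ∀ y ∈ s, G.Adj x y → f x ≠ f y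

lemma Col.mono {s t : Set V} {m n : ℕ} (hs : Col G s m) (hts : t ⊆ s) (hmn : m ≤ n) :
    Col G t n := by
  obtain ⟨f, h1, h2⟩ := hs
  exact ⟨f, fun x hx => (h1 x (hts hx)).trans_le hmn,
    fun x hx y hy => h2 x (hts hx) y (hts hy)⟩

lemma Col.union {s t : Set V} {m n : ℕ} (hs : Col G s m) (ht : Col G t n) :
    Col G (s ∪ t) (m + n) := by
  classical
  obtain ⟨f, h1, h2⟩ := hs
  obtain ⟨g, h3, h4⟩ := ht
  refine ⟨fun x => if x ∈ s then f x else m + g x, ?_, ?_⟩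
  · intro x hx
    by_cases hxs : x ∈ s
    · have := h1 x hxs
      simp [hxs]; omega
    · have := h3 x (hx.resolve_left hxs)
      simp [hxs]; omega
  · intro x hx y hy hxy
    by_cases hxs : x ∈ s <;> by_cases hys : y ∈ s <;> simp only [hxs, hys, if_true, if_false]
    · exact h2 x hxs y hys hxy
    · have := h1 x hxs; omega
    · have := h1 y hys; omega
    · have := h4 x (hx.resolve_left hxs) y (hy.resolve_left hys) hxy
      omega

lemma Col.anti {s t : Set V} {n : ℕ} (hs : Col G s n) (ht : Col G t n)
    (hst : ∀ x ∈ s, ∀ y ∈ t, ¬ G.Adj x y) : Col G (s ∪ t) n := by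
  classical
  obtain ⟨f, h1, h2⟩ := hs
  obtain ⟨g, h3, h4⟩ := ht
  refine ⟨fun x => if x ∈ s then f x else g x, ?_, ?_⟩
  · intro x hx
    by_cases hxs : x ∈ s
    · simpa [hxs] using h1 x hxs
    · simpa [hxs] using h3 x (hx.resolve_left hxs)
  · intro x hx y hy hxy
    by_cases hxs : x ∈ s <;> by_cases hys : y ∈ s <;> simp only [hxs, hys, if_true, if_false]
    · exact h2 x hxs y hys hxy
    · exact (hst x hxs y (hy.resolve_left hys) hxy).elim
    · exact (hst y hys x (hx.resolve_left hxs) hxy.symm).elim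
    · exact h4 x (hx.resolve_left hxs) y (hy.resolve_left hys) hxy

lemma Col.stable {s : Set V} (hs : ∀ x ∈ s, ∀ y ∈ s, ¬ G.Adj x y) : Col G s 1 :=
  ⟨fun _ => 0, by simp, fun x hx y hy hxy => (hs x hx y hy hxy).elim⟩

lemma Col.card [Finite V] (s : Set V) : Col G s s.ncard := by
  classical
  have : Fintype s := Fintype.ofFinite s
  have e := Fintype.equivFin s
  have hc : s.ncard = Fintype.card s := by
    rw [← Nat.card_coe_set_eq, Nat.card_eq_fintype_card]
  refine ⟨fun x => if hx : x ∈ s then (e ⟨x, hx⟩ : ℕ) else 0, ?_, ?_⟩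
  · intro x hx
    simp only [hx, dif_pos]
    rw [hc]
    exact (e ⟨x, hx⟩).2
  · intro x hx y hy hxy heq
    simp only [hx, hy, dif_pos] at heq
    have := e.injective (Fin.ext heq)
    simp only [Subtype.mk.injEq] at this
    subst this
    exact G.irrefl hxy

/-- A clique plus one vertex. -/
lemma Col.insert_clique [Finite V] {s : Set V} {z : V} {m : ℕ} (hs : G.IsClique s)
    (hb : ∀ Z : Set V, Z ⊆ insert z s → G.IsClique Z → Z.ncard ≤ m) : Col G (insert z s) m := by
  classical
  by_cases hcl : G.IsClique (insert z s)
  · exact (Col.card _).mono subset_rfl (hb _ subset_rfl hcl)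
  · obtain ⟨y, hy, hyz, hne⟩ : ∃ y ∈ s, ¬ G.Adj z y ∧ z ≠ y := by
      by_contra hcon
      push Not at hcon
      apply hcl
      rw [SimpleGraph.isClique_insert]
      exact ⟨hs, fun b hb hne => by_contra fun hn => hne (hcon b hb hn)⟩
    obtain ⟨f, h1, h2⟩ := (Col.card (G := G) s).mono subset_rfl (hb s (Set.subset_insert _ _) hs)
    have hcl' : ∀ u ∈ s, u ≠ y → f y ≠ f u := fun u hu hn => h2 y hy u hu (hs hy hu hn.symm)
    refine ⟨fun x => if x = z then f y else f x, ?_, ?_⟩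
    · intro x hx
      by_cases hxz : x = z
      · simpa [hxz] using h1 y hy
      · simpa [hxz] using h1 x (hx.resolve_left hxz)
    · intro u hu w hw huw
      by_cases huz : u = z <;> by_cases hwz : w = z <;> simp only [huz, hwz, if_true, if_false]
      · subst huz; subst hwz; exact (G.irrefl huw).elim
      · refine hcl' w (hw.resolve_left hwz) ?_
        rintro rfl; subst huz; exact hyz huw
      · refine (hcl' u (hu.resolve_left huz) ?_).symm
        rintro rfl; subst hwz; exact hyz huw.symm
      · exact h2 u (hu.resolve_left huz) w (hw.resolve_left hwz) huw

lemma clique_card [Finite V] {Z W : Set V} (hZ : G.IsClique Z) (hW : G.IsClique W)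
    (hZW : ∀ x ∈ Z, ∀ y ∈ W, G.Adj x y) : Z.ncard + W.ncard ≤ G.cliqueNum := by
  classical
  have : Fintype V := Fintype.ofFinite V
  have hd : Disjoint Z W := by
    rw [Set.disjoint_left]
    intro x hx hy
    exact G.irrefl (hZW x hx x hy)
  rw [← Set.ncard_union_eq hd]
  have hc : G.IsClique (Z ∪ W) := by
    intro x hx y hy hne
    rcases hx with hx | hx <;> rcases hy with hy | hy
    · exact hZ hx hy hne
    · exact hZW x hx y hy
    · exact (hZW y hy x hx).symm
    · exact hW hx hy hne
  rw [Set.ncard_eq_toFinset_card']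
  apply SimpleGraph.IsClique.card_le_cliqueNum
  simpa using hc

lemma Col.colorable {n : ℕ} (hs : Col G Set.univ n) : G.Colorable n := by
  obtain ⟨f, h1, h2⟩ := hs
  exact ⟨SimpleGraph.Coloring.mk (fun x => ⟨f x, h1 x trivial⟩)
    (fun {x y} hxy heq => h2 x trivial y trivial hxy (by simpa using heq))⟩

end

section
variable {V : Type*} {G : SimpleGraph V} {a b c d e h : V}

lemma Hub.rot {x : V} (hx : Hub G a b c d e x) : Hub G b c d e a x :=
  ⟨hx.2.1, hx.2.2.1, hx.2.2.2.1, hx.2.2.2.2, hx.1⟩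

lemma Hub.rev {x : V} (hx : Hub G a b c d e x) : Hub G a e d c b x :=
  ⟨hx.1, hx.2.2.2.2, hx.2.2.2.1, hx.2.2.1, hx.2.1⟩

/-- A clique inside `T_a ∪ T_b` together with `H` and `a, b` is a clique. -/
lemma pair_bound [Finite V] (W : WFree G) (C : IsC5 G a b c d e) {H : Set V}
    (hH : ∀ x ∈ H, Hub G a b c d e x) {Z : Set V} (hZ : G.IsClique Z)
    (hZT : ∀ x ∈ Z, TT G a b c d e x ∨ TT G b c d e a x) :
    Z.ncard + (H.ncard + 2) ≤ G.cliqueNum := by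
  have hHc : G.IsClique H := fun x hx y hy hne => hub_clique W C (hH x hx) (hH y hy) hne
  have h2 : ({a, b} : Set V).ncard = 2 := Set.ncard_pair C.ab.ne
  have hab : G.IsClique ({a, b} : Set V) := by
    rw [SimpleGraph.isClique_pair]; exact fun _ => C.ab
  have hHab : ∀ x ∈ H, ∀ y ∈ ({a, b} : Set V), G.Adj x y := by
    rintro x hx y (rfl | rfl)
    · exact (hH x hx).1
    · exact (hH x hx).2.1
  have hd : Disjoint H {a, b} := by
    rw [Set.disjoint_left]
    intro x hx hy
    exact G.irrefl (hHab x hx x hy)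
  have hcl : G.IsClique (H ∪ {a, b}) := by
    intro x hx y hy hne
    rcases hx with hx | hx <;> rcases hy with hy | hy
    · exact hHc hx hy hne
    · exact hHab x hx y hy
    · exact (hHab y hy x hx).symm
    · exact hab hx hy hne
  have := clique_card hZ hcl ?_
  · rw [Set.ncard_union_eq hd, h2] at this
    exact this
  · intro x hx y hy
    rcases hy with hy | rfl | rfl
    · rcases hZT x hx with ht | ht
      · exact tt_hub W C (hH y hy) ht
      · exact tt_hub W C.rot (hH y hy).rot ht
    · rcases hZT x hx with ht | ht
      · exact ht.1
      · exact ht.2.2.2.2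
    · rcases hZT x hx with ht | ht
      · exact ht.2.1
      · exact ht.1

lemma pair_col [Finite V] (P : PFree G) (W : WFree G) (C : IsC5 G a b c d e)
    (hh : Hub G a b c d e h) {m : ℕ}
    (hb : ∀ Z : Set V, G.IsClique Z → (∀ x ∈ Z, TT G a b c d e x ∨ TT G b c d e a x) →
      Z.ncard ≤ m) :
    Col G {x | TT G a b c d e x ∨ TT G b c d e a x} m := by
  by_cases hcl : G.IsClique {x | TT G a b c d e x ∨ TT G b c d e a x}
  · exact (Col.card _).mono subset_rfl (hb _ hcl fun x hx => hx)
  · obtain ⟨x, y, hx, hy, hn⟩ : ∃ x y, TT G a b c d e x ∧ TT G b c d e a y ∧ ¬ G.Adj x y := by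
      by_contra hcon
      push Not at hcon
      apply hcl
      rintro x (hx | hx) y (hy | hy) hne
      · exact tt_clique W C hx hy hne
      · exact hcon x y hx hy
      · exact (hcon y x hy hx).symm
      · exact tt_clique W C.rot hx hy hne
    have key : Col G (insert x {z | (TT G a b c d e z ∨ TT G b c d e a z) ∧ z ≠ x}) m := by
      apply Col.insert_clique
      · rintro u ⟨hu | hu, hux⟩ w ⟨hw | hw, hwx⟩ hne
        · exact tt_clique W C hu hw hne
        · exact tt_nonedge P W C hh hx hu hy hw hn (Or.inl hux.symm)
        · exact (tt_nonedge P W C hh hx hw hy hu hn (Or.inl hwx.symm)).symm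
        · exact tt_clique W C.rot hu hw hne
      · intro Z hZ hZc
        refine hb Z hZc fun z hz => ?_
        rcases hZ hz with rfl | hz
        · exact Or.inl hx
        · exact hz.1
    refine key.mono ?_ le_rfl
    intro z hz
    by_cases hzx : z = x
    · exact Or.inl hzx
    · exact Or.inr ⟨hz, hzx⟩

/-- Colouring `T`, possibly with an additional set `Y` attached to `T_a`. -/
lemma all_col [Finite V] (P : PFree G) (W : WFree G) (C : IsC5 G a b c d e)
    (hh : Hub G a b c d e h) {m : ℕ}
    (hb : ∀ Z : Set V, G.IsClique Z → (∀ x ∈ Z, TT G b c d e a x ∨ TT G c d e a b x) →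
      Z.ncard ≤ m)
    (hbD : {x | TT G d e a b c x}.ncard ≤ m) (hbE : {x | TT G e a b c d x}.ncard ≤ m)
    {Y : Set V} (hY : Col G ({x | TT G a b c d e x} ∪ Y) m)
    (hYD : ∀ y ∈ Y, ∀ x, TT G d e a b c x → ¬ G.Adj x y) :
    Col G (({x | TT G a b c d e x} ∪ Y ∪ {x | TT G d e a b c x}) ∪
      ({x | TT G b c d e a x ∨ TT G c d e a b x} ∪ {x | TT G e a b c d x})) (m + m) := by
  refine Col.union (Col.anti hY ((Col.card _).mono subset_rfl hbD) ?_)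
    (Col.anti (pair_col P W C.rot hh.rot hb) ((Col.card _).mono subset_rfl hbE) ?_)
  · rintro x (hx | hx) y hy hxy
    · exact tt_anti W C.rot.rot.rot hh.rot.rot.rot hy hx hxy.symm
    · exact hYD x hx y hy hxy.symm
  · rintro x (hx | hx) y hy hxy
    · exact tt_anti W C.rot.rot.rot.rot hh.rot.rot.rot.rot hy hx hxy.symm
    · exact tt_anti W C.rot.rot hh.rot.rot hx hy hxy

/-- The possible neighbourhoods of the members of `X`. -/
def AnySub2 (G : SimpleGraph V) (a b c d e x : V) : Prop :=
  Sub2 G c d e x ∨ Sub2 G d e a x ∨ Sub2 G e a b x ∨ Sub2 G a b c x ∨ Sub2 G b c d x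

def AnyTT (G : SimpleGraph V) (a b c d e x : V) : Prop :=
  TT G a b c d e x ∨ TT G b c d e a x ∨ TT G c d e a b x ∨ TT G d e a b c x ∨ TT G e a b c d x

lemma AnySub2.rot {x : V} (hx : AnySub2 G a b c d e x) : AnySub2 G b c d e a x := by
  unfold AnySub2 at *; tauto

lemma AnyTT.rot {x : V} (hx : AnyTT G a b c d e x) : AnyTT G b c d e a x := by
  unfold AnyTT at *; tauto

lemma AnyTT.mem {x : V} {Y : Set V} (hx : AnyTT G a b c d e x) :
    x ∈ (({x | TT G a b c d e x} ∪ Y ∪ {x | TT G d e a b c x}) ∪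
      ({x | TT G b c d e a x ∨ TT G c d e a b x} ∪ {x | TT G e a b c d x})) := by
  rcases hx with hx | hx | hx | hx | hx
  · exact Or.inl (Or.inl (Or.inl hx))
  · exact Or.inr (Or.inl (Or.inl hx))
  · exact Or.inr (Or.inl (Or.inr hx))
  · exact Or.inl (Or.inr hx)
  · exact Or.inr (Or.inr hx)

lemma AnySub2.three {x : V} (hx : AnySub2 G a b c d e x)
    (hE : ¬ (G.Adj x a ∧ G.Adj x b) ∧ ¬ (G.Adj x b ∧ G.Adj x c) ∧
      ¬ (G.Adj x c ∧ G.Adj x d) ∧ ¬ (G.Adj x d ∧ G.Adj x e) ∧ ¬ (G.Adj x e ∧ G.Adj x a)) :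
    Sub2 G c d e x ∨ Sub2 G e a b x ∨ Sub2 G b c d x := by
  unfold AnySub2 Sub2 at *
  by_cases p1 : G.Adj x a <;> by_cases p2 : G.Adj x b <;> by_cases p3 : G.Adj x c <;>
  by_cases p4 : G.Adj x d <;> by_cases p5 : G.Adj x e <;>
  simp_all

lemma five_cases {qA qB qC qD qE NA NB NC ND NE : Prop} (eA : qA → NC ∧ ND) (eB : qB → ND ∧ NE)
    (eC : qC → NE ∧ NA) (eD : qD → NA ∧ NB) (eE : qE → NB ∧ NC) :
    (¬ qB ∧ ¬ qC ∧ ¬ qD ∧ ¬ qE) ∨ (¬ qC ∧ ¬ qD ∧ ¬ qE ∧ ¬ qA) ∨ (¬ qD ∧ ¬ qE ∧ ¬ qA ∧ ¬ qB) ∨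
    (¬ qE ∧ ¬ qA ∧ ¬ qB ∧ ¬ qC) ∨ (¬ qA ∧ ¬ qB ∧ ¬ qC ∧ ¬ qD) ∨
    (NC ∧ ND ∧ NE) ∨ (ND ∧ NE ∧ NA) ∨ (NE ∧ NA ∧ NB) ∨ (NA ∧ NB ∧ NC) ∨ (NB ∧ NC ∧ ND) := by
  by_cases p1 : qA <;> by_cases p2 : qB <;> by_cases p3 : qC <;>
  by_cases p4 : qD <;> by_cases p5 : qE <;>
  simp_all

lemma AnyTT.single {x : V} (hx : AnyTT G a b c d e x)
    (hn : (¬ ∃ z, TT G b c d e a z) ∧ (¬ ∃ z, TT G c d e a b z) ∧ (¬ ∃ z, TT G d e a b c z) ∧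
      ¬ ∃ z, TT G e a b c d z) : TT G a b c d e x := by
  rcases hx with hx | hx | hx | hx | hx
  · exact hx
  · exact (hn.1 ⟨x, hx⟩).elim
  · exact (hn.2.1 ⟨x, hx⟩).elim
  · exact (hn.2.2.1 ⟨x, hx⟩).elim
  · exact (hn.2.2.2 ⟨x, hx⟩).elim

/-- If `E_a` is nonempty, the rest of `X` is stable: description of the remaining vertices. -/
lemma edge_rest (P : PFree G) (W : WFree G) (C : IsC5 G a b c d e)
    (hh : Hub G a b c d e h) {x₀ x : V} (h0 : G.Adj x₀ h) (h0a : G.Adj x₀ a) (h0b : G.Adj x₀ b)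
    (h0s : Sub2 G c d e x₀) (hx : G.Adj x h) (hxs : AnySub2 G a b c d e x) (hne : x ≠ x₀) :
    (¬ G.Adj x a ∧ ¬ G.Adj x b ∧ ¬ G.Adj x c ∧ ¬ G.Adj x e) ∨
    (G.Adj x b ∧ G.Adj x c ∧ Sub2 G d e a x) ∨ (G.Adj x e ∧ G.Adj x a ∧ Sub2 G b c d x) := by
  have f1 : Sub2 G c d e x → ¬ G.Adj x a := fun hs hxa => hne (sub2_unique P C hs h0s hxa h0a)
  have f2 : Sub2 G c d e x → ¬ G.Adj x b := fun hs hxb =>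
    hne (sub2_unique P C.rev.rot.rot.rot.rot (a := b) ⟨hs.2.2, hs.2.1, hs.1⟩
      ⟨h0s.2.2, h0s.2.1, h0s.1⟩ hxb h0b)
  have f3 : Sub2 G e a b x → ¬ G.Adj x c := fun hs hxc =>
    edge_conf P W C hh h0 hx h0s h0a h0b hxc hs
  have f4 : Sub2 G c b a x → ¬ G.Adj x e := fun hs hxe =>
    edge_conf P W C.rev.rot.rot.rot.rot hh.rev.rot.rot.rot.rot h0 hx
      ⟨h0s.2.2, h0s.2.1, h0s.1⟩ h0b h0a hxe hs
  clear h0 h0a h0b h0s hx hne P W C hh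
  unfold AnySub2 Sub2 at *
  by_cases p1 : G.Adj x a <;> by_cases p2 : G.Adj x b <;> by_cases p3 : G.Adj x c <;>
  by_cases p4 : G.Adj x d <;> by_cases p5 : G.Adj x e <;>
  simp_all

lemma edge_rest_stable (P : PFree G) (W : WFree G) (C : IsC5 G a b c d e)
    (hh : Hub G a b c d e h) {x₀ x y : V} (h0 : G.Adj x₀ h) (h0a : G.Adj x₀ a)
    (h0b : G.Adj x₀ b) (h0s : Sub2 G c d e x₀)
    (hx : G.Adj x h) (hxs : AnySub2 G a b c d e x) (hxne : x ≠ x₀)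
    (hy : G.Adj y h) (hys : AnySub2 G a b c d e y) (hyne : y ≠ x₀) : ¬ G.Adj x y := by
  have eB : ∀ u w, G.Adj u h → G.Adj w h →
      (¬ G.Adj u a ∧ ¬ G.Adj u b ∧ ¬ G.Adj u c ∧ ¬ G.Adj u e) →
      (G.Adj w b ∧ G.Adj w c ∧ Sub2 G d e a w) → ¬ G.Adj u w := by
    intro u w hu hw hu' hw'
    by_cases hud : G.Adj u d
    · exact (edge_conf P W C.rot hh.rot hw hu hw'.2.2 hw'.1 hw'.2.1 hud
        ⟨hu'.1, hu'.2.1, hu'.2.2.1⟩).elim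
    · exact sub2_stable P C.rot ⟨hud, hu'.2.2.2, hu'.1⟩ hw'.2.2
  have eE : ∀ u w, G.Adj u h → G.Adj w h →
      (¬ G.Adj u a ∧ ¬ G.Adj u b ∧ ¬ G.Adj u c ∧ ¬ G.Adj u e) →
      (G.Adj w e ∧ G.Adj w a ∧ Sub2 G b c d w) → ¬ G.Adj u w := by
    intro u w hu hw hu' hw'
    by_cases hud : G.Adj u d
    · exact (edge_conf P W C.rev hh.rev hw hu ⟨hw'.2.2.2.2, hw'.2.2.2.1, hw'.2.2.1⟩
        hw'.2.1 hw'.1 hud ⟨hu'.2.1, hu'.1, hu'.2.2.2⟩).elim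
    · exact sub2_stable P C.rot.rot.rot.rot ⟨hu'.2.1, hu'.2.2.1, hud⟩ hw'.2.2
  have eBE : ∀ u w, G.Adj u h → G.Adj w h → (G.Adj u b ∧ G.Adj u c ∧ Sub2 G d e a u) →
      (G.Adj w e ∧ G.Adj w a ∧ Sub2 G b c d w) → False := by
    intro u w hu hw hu' hw'
    exact edge_conf P W C.rot.rot.rot.rot hh.rot.rot.rot.rot hw hu hw'.2.2 hw'.1 hw'.2.1 hu'.1
      hu'.2.2
  rcases edge_rest P W C hh h0 h0a h0b h0s hx hxs hxne with hx' | hx' | hx' <;>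
  rcases edge_rest P W C hh h0 h0a h0b h0s hy hys hyne with hy' | hy' | hy'
  · exact sub2_stable P C.rot.rot.rot ⟨hx'.1, hx'.2.1, hx'.2.2.1⟩ ⟨hy'.1, hy'.2.1, hy'.2.2.1⟩
  · exact eB x y hx hy hx' hy'
  · exact eE x y hx hy hx' hy'
  · exact fun t => eB y x hy hx hy' hx' t.symm
  · exact sub2_stable P C.rot hx'.2.2 hy'.2.2
  · exact (eBE x y hx hy hx' hy').elim
  · exact fun t => eE y x hy hx hy' hx' t.symm
  · exact (eBE y x hy hx hy' hx').elim
  · exact sub2_stable P C.rot.rot.rot.rot hx'.2.2 hy'.2.2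

/-- Clique bounds for all parts of `T`. -/
lemma single_bound [Finite V] (W : WFree G) (C : IsC5 G a b c d e) {H : Set V}
    (hH : ∀ x ∈ H, Hub G a b c d e x) :
    {x | TT G a b c d e x}.ncard + (H.ncard + 2) ≤ G.cliqueNum :=
  pair_bound W C hH (fun _ hx _ hy hne => tt_clique W C hx hy hne) (fun _ hx => Or.inl hx)

/-- The case where `E_a` is nonempty. -/
lemma case_edge [Finite V] (P : PFree G) (W : WFree G) (C : IsC5 G a b c d e) {H X T : Set V}
    (hH : ∀ x ∈ H, Hub G a b c d e x) (hh : h ∈ H)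
    (hX : ∀ x ∈ X, G.Adj x h ∧ AnySub2 G a b c d e x) (hT : ∀ x ∈ T, AnyTT G a b c d e x)
    {x₀ : V} (h0 : G.Adj x₀ h) (h0a : G.Adj x₀ a) (h0b : G.Adj x₀ b) (h0s : Sub2 G c d e x₀)
    {m : ℕ} (hm : m + (H.ncard + 2) = G.cliqueNum) :
    Col G (T ∪ X) (2 * m + H.ncard) := by
  have hhub := hH h hh
  have hH1 : ∀ x ∈ H, Hub G b c d e a x := fun x hx => (hH x hx).rot
  have hH3 : ∀ x ∈ H, Hub G d e a b c x := fun x hx => (hH x hx).rot.rot.rot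
  have hH4 : ∀ x ∈ H, Hub G e a b c d x := fun x hx => (hH x hx).rot.rot.rot.rot
  have bA := single_bound W C hH
  have bD := single_bound W C.rot.rot.rot hH3
  have bE := single_bound W C.rot.rot.rot.rot hH4
  have bP : ∀ Z : Set V, G.IsClique Z → (∀ x ∈ Z, TT G b c d e a x ∨ TT G c d e a b x) →
      Z.ncard ≤ m := by
    intro Z hZ hZ'
    have := pair_bound W C.rot hH1 hZ hZ'
    omega
  have hXs : Col G (X \ {x₀}) 1 := by
    apply Col.stable
    rintro x ⟨hx, hxne⟩ y ⟨hy, hyne⟩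
    exact edge_rest_stable P W C hhub h0 h0a h0b h0s (hX x hx).1 (hX x hx).2 hxne
      (hX y hy).1 (hX y hy).2 hyne
  have hk : 1 ≤ H.ncard := by
    exact (Set.ncard_pos (Set.toFinite H)).2 ⟨h, hh⟩
  by_cases hk1 : H.ncard = 1
  · have hY : Col G ({x | TT G a b c d e x} ∪ {x₀}) m := by
      rw [Set.union_singleton]
      apply Col.insert_clique
      · exact fun x hx y hy hne => tt_clique W C hx hy hne
      · intro Z hZ hZc
        have h3 : ({h, a, b} : Set V).ncard = 3 :=
          Set.ncard_eq_three.2 ⟨h, a, b, hhub.1.ne, hhub.2.1.ne, C.ab.ne, rfl⟩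
        have hc3 : G.IsClique ({h, a, b} : Set V) := by
          intro u hu w hw hne
          rcases hu with rfl | rfl | rfl <;> rcases hw with rfl | rfl | rfl
          · exact (hne rfl).elim
          · exact hhub.1
          · exact hhub.2.1
          · exact hhub.1.symm
          · exact (hne rfl).elim
          · exact C.ab
          · exact hhub.2.1.symm
          · exact C.ab.symm
          · exact (hne rfl).elim
        have := clique_card hZc hc3 ?_
        · omega
        · intro x hx y hy
          rcases hZ hx with rfl | hx
          · rcases hy with rfl | rfl | rfl
            · exact h0
            · exact h0a
            · exact h0b
          · rcases hy with rfl | rfl | rfl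
            · exact tt_hub W C hhub hx
            · exact hx.1
            · exact hx.2.1
    have hall := all_col P W C hhub bP (by omega) (by omega) hY (by
      rintro y rfl x hx
      exact tt_edge_anti W C.rot.rot.rot hhub.rot.rot.rot h0 hx h0a h0s)
    refine (hall.union hXs).mono ?_ (by omega)
    rintro x (hx | hx)
    · exact Or.inl (hT x hx).mem
    · by_cases hx0 : x = x₀
      · left; left; left; right; exact hx0
      · exact Or.inr ⟨hx, hx0⟩
  · have hall := all_col P W C hhub bP (by omega) (by omega) (Y := ∅) (by
      rw [Set.union_empty]
      exact (Col.card _).mono subset_rfl (by omega)) (by simp)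
    have hx1 : Col G ({x₀} : Set V) 1 := by
      apply Col.stable
      rintro x rfl y rfl
      exact G.irrefl
    refine (hall.union (hx1.union hXs)).mono ?_ (by omega)
    rintro x (hx | hx)
    · exact Or.inl (hT x hx).mem
    · right
      by_cases hx0 : x = x₀
      · exact Or.inl hx0
      · exact Or.inr ⟨hx, hx0⟩

/-- If no `E`-vertex exists and `T_a ≠ ∅`, no vertex of `X` sees `c` or `d`. -/
lemma tt_excl (P : PFree G) (W : WFree G) (C : IsC5 G a b c d e) (hh : Hub G a b c d e h)
    {X : Set V} (hX : ∀ x ∈ X, G.Adj x h ∧ AnySub2 G a b c d e x)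
    (hE : ∀ x ∈ X, ¬ (G.Adj x a ∧ G.Adj x b) ∧ ¬ (G.Adj x b ∧ G.Adj x c) ∧
      ¬ (G.Adj x c ∧ G.Adj x d) ∧ ¬ (G.Adj x d ∧ G.Adj x e) ∧ ¬ (G.Adj x e ∧ G.Adj x a))
    (hT : ∃ z, TT G a b c d e z) : (∀ x ∈ X, ¬ G.Adj x c) ∧ (∀ x ∈ X, ¬ G.Adj x d) := by
  obtain ⟨z, hz⟩ := hT
  constructor
  · intro x hx hxc
    obtain ⟨h1, h2⟩ := hX x hx
    have h3 := hE x hx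
    refine tt_conf P W C hh h1 hz hxc (by tauto) ?_
    unfold AnySub2 Sub2 at *
    tauto
  · intro x hx hxd
    obtain ⟨h1, h2⟩ := hX x hx
    have h3 := hE x hx
    refine tt_conf P W C.rev hh.rev (x := z) h1
      ⟨hz.1, hz.2.2.2.2, hz.2.2.2.1, hz.2.2.1, hz.2.1⟩ hxd (by tauto) ?_
    unfold AnySub2 Sub2 at *
    tauto

lemma case_noedge [Finite V] (P : PFree G) (W : WFree G) (C : IsC5 G a b c d e) {H X T : Set V}
    (hH : ∀ x ∈ H, Hub G a b c d e x) (hh : h ∈ H)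
    (hX : ∀ x ∈ X, G.Adj x h ∧ AnySub2 G a b c d e x) (hT : ∀ x ∈ T, AnyTT G a b c d e x)
    (hE : ∀ x ∈ X, ¬ (G.Adj x a ∧ G.Adj x b) ∧ ¬ (G.Adj x b ∧ G.Adj x c) ∧
      ¬ (G.Adj x c ∧ G.Adj x d) ∧ ¬ (G.Adj x d ∧ G.Adj x e) ∧ ¬ (G.Adj x e ∧ G.Adj x a))
    {m : ℕ} (hm : m + (H.ncard + 2) = G.cliqueNum) (hω : 5 ≤ G.cliqueNum) :
    Col G (T ∪ X) (2 * m + H.ncard) := by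
  have hhub := hH h hh
  have hH1 : ∀ x ∈ H, Hub G b c d e a x := fun x hx => (hH x hx).rot
  have hH2 : ∀ x ∈ H, Hub G c d e a b x := fun x hx => (hH x hx).rot.rot
  have hH3 : ∀ x ∈ H, Hub G d e a b c x := fun x hx => (hH x hx).rot.rot.rot
  have hH4 : ∀ x ∈ H, Hub G e a b c d x := fun x hx => (hH x hx).rot.rot.rot.rot
  have bA := single_bound W C hH
  have bB := single_bound W C.rot hH1
  have bC := single_bound W C.rot.rot hH2
  have bD := single_bound W C.rot.rot.rot hH3
  have bE := single_bound W C.rot.rot.rot.rot hH4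
  have hk : 1 ≤ H.ncard := by
    exact (Set.ncard_pos (Set.toFinite H)).2 ⟨h, hh⟩
  have eA := tt_excl P W C hhub hX hE
  have eB := tt_excl P W C.rot hhub.rot (fun x hx => ⟨(hX x hx).1, (hX x hx).2.rot⟩)
    (fun x hx => let t := hE x hx; ⟨t.2.1, t.2.2.1, t.2.2.2.1, t.2.2.2.2, t.1⟩)
  have eC := tt_excl P W C.rot.rot hhub.rot.rot (fun x hx => ⟨(hX x hx).1, (hX x hx).2.rot.rot⟩)
    (fun x hx => let t := hE x hx; ⟨t.2.2.1, t.2.2.2.1, t.2.2.2.2, t.1, t.2.1⟩)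
  have eD := tt_excl P W C.rot.rot.rot hhub.rot.rot.rot
    (fun x hx => ⟨(hX x hx).1, (hX x hx).2.rot.rot.rot⟩)
    (fun x hx => let t := hE x hx; ⟨t.2.2.2.1, t.2.2.2.2, t.1, t.2.1, t.2.2.1⟩)
  have eE := tt_excl P W C.rot.rot.rot.rot hhub.rot.rot.rot.rot
    (fun x hx => ⟨(hX x hx).1, (hX x hx).2.rot.rot.rot.rot⟩)
    (fun x hx => let t := hE x hx; ⟨t.2.2.2.2, t.1, t.2.1, t.2.2.1, t.2.2.2.1⟩)
  -- if `X` is stable we are done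
  have st : (∀ x ∈ X, ∀ y ∈ X, ¬ G.Adj x y) → Col G (T ∪ X) (2 * m + H.ncard) := by
    intro hs
    have hall := all_col P W C hhub (m := m)
      (by
        intro Z hZ hZ'
        have := pair_bound W C.rot hH1 hZ hZ'
        omega) (by omega) (by omega) (Y := ∅) (by
      rw [Set.union_empty]
      exact (Col.card _).mono subset_rfl (by omega)) (by simp)
    refine (hall.union (Col.stable hs)).mono ?_ (by omega)
    rintro x (hx | hx)
    · exact Or.inl (hT x hx).mem
    · exact Or.inr hx
  -- if `T` is a single part we are done
  have sg : Col G T m → Col G (T ∪ X) (2 * m + H.ncard) := by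
    intro hTm
    have s1 : Col G {x | Sub2 G c d e x} 1 :=
      Col.stable fun x hx y hy => sub2_stable P C hx hy
    have s2 : Col G {x | Sub2 G e a b x} 1 :=
      Col.stable fun x hx y hy => sub2_stable P C.rot.rot hx hy
    have s3 : Col G {x | Sub2 G b c d x} 1 :=
      Col.stable fun x hx y hy => sub2_stable P C.rot.rot.rot.rot hx hy
    refine (hTm.union (s1.union (s2.union s3))).mono ?_ (by omega)
    rintro x (hx | hx)
    · exact Or.inl hx
    · right
      rcases (hX x hx).2.three (hE x hx) with h1 | h1 | h1
      · exact Or.inl h1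
      · exact Or.inr (Or.inl h1)
      · exact Or.inr (Or.inr h1)
  rcases five_cases eA eB eC eD eE with q | q | q | q | q | q | q | q | q | q
  · exact sg ((Col.card {x | TT G a b c d e x}).mono
      (fun x hx => (hT x hx).single q) (by omega))
  · exact sg ((Col.card {x | TT G b c d e a x}).mono
      (fun x hx => (AnyTT.rot (hT x hx)).single q) (by omega))
  · exact sg ((Col.card {x | TT G c d e a b x}).mono
      (fun x hx => (AnyTT.rot (AnyTT.rot (hT x hx))).single q) (by omega))
  · exact sg ((Col.card {x | TT G d e a b c x}).mono
      (fun x hx => (AnyTT.rot (AnyTT.rot (AnyTT.rot (hT x hx)))).single q) (by omega))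
  · exact sg ((Col.card {x | TT G e a b c d x}).mono
      (fun x hx => (AnyTT.rot (AnyTT.rot (AnyTT.rot (AnyTT.rot (hT x hx))))).single q) (by omega))
  · exact st fun x hx y hy => sub2_stable P C ⟨q.1 x hx, q.2.1 x hx, q.2.2 x hx⟩
      ⟨q.1 y hy, q.2.1 y hy, q.2.2 y hy⟩
  · exact st fun x hx y hy => sub2_stable P C.rot ⟨q.1 x hx, q.2.1 x hx, q.2.2 x hx⟩
      ⟨q.1 y hy, q.2.1 y hy, q.2.2 y hy⟩
  · exact st fun x hx y hy => sub2_stable P C.rot.rot ⟨q.1 x hx, q.2.1 x hx, q.2.2 x hx⟩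
      ⟨q.1 y hy, q.2.1 y hy, q.2.2 y hy⟩
  · exact st fun x hx y hy => sub2_stable P C.rot.rot.rot ⟨q.1 x hx, q.2.1 x hx, q.2.2 x hx⟩
      ⟨q.1 y hy, q.2.1 y hy, q.2.2 y hy⟩
  · exact st fun x hx y hy => sub2_stable P C.rot.rot.rot.rot ⟨q.1 x hx, q.2.1 x hx, q.2.2 x hx⟩
      ⟨q.1 y hy, q.2.1 y hy, q.2.2 y hy⟩

/-- Colouring the cycle, the hub and its non-neighbours with five colours. -/
lemma base_col (P : PFree G) (C : IsC5 G a b c d e) (hh : Hub G a b c d e h) :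
    Col G {x | x = h ∨ x = a ∨ x = b ∨ x = c ∨ x = d ∨ x = e ∨ (¬ G.Adj x h ∧
      ((¬ G.Adj x a ∧ ¬ G.Adj x c) ∨ (¬ G.Adj x b ∧ ¬ G.Adj x d) ∨ (¬ G.Adj x c ∧ ¬ G.Adj x e) ∨
      (¬ G.Adj x d ∧ ¬ G.Adj x a) ∨ (¬ G.Adj x e ∧ ¬ G.Adj x b)))} 5 := by
  -- a stable class: vertices missing the nonadjacent cycle vertices `p`, `q`
  have cls : ∀ p q : V, G.Adj h p → G.Adj h q → ¬ G.Adj p q → p ≠ q →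
      ∀ x y, ¬ G.Adj x h → ¬ G.Adj y h → ¬ G.Adj x p → ¬ G.Adj x q → ¬ G.Adj y p →
      ¬ G.Adj y q → ¬ G.Adj x y := by
    intro p q hp hq hpq hne x y h1 h2 h3 h4 h5 h6 hxy
    exact P p h q x y hp.symm hq hpq hne hxy (fun t => h3 t.symm) (fun t => h5 t.symm)
      (fun t => h1 t.symm) (fun t => h2 t.symm) (fun t => h4 t.symm) (fun t => h6 t.symm)
  -- classes together with `p, q` themselves
  have clp : ∀ p q : V, G.Adj h p → G.Adj h q → ¬ G.Adj p q → p ≠ q →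
      Col G {x | x = p ∨ x = q ∨ (¬ G.Adj x h ∧ ¬ G.Adj x p ∧ ¬ G.Adj x q)} 1 := by
    intro p q hp hq hpq hne
    apply Col.stable
    rintro x (rfl | rfl | hx) y (rfl | rfl | hy) hxy
    · exact G.irrefl hxy
    · exact hpq hxy
    · exact hy.2.1 hxy.symm
    · exact hpq hxy.symm
    · exact G.irrefl hxy
    · exact hy.2.2 hxy.symm
    · exact hx.2.1 hxy
    · exact hx.2.2 hxy
    · exact cls p q hp hq hpq hne x y hx.1 hy.1 hx.2.1 hx.2.2 hy.2.1 hy.2.2 hxy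
  obtain ⟨ha, hb, hc, hd, he⟩ := hh
  obtain ⟨nac, neb, nbd, nce, nda⟩ := C.ne
  have c1 := clp a c ha hc C.ac nac
  have c2 := clp b d hb hd C.bd nbd
  have c3 := clp c e hc he C.ce nce
  have c4 := clp d a hd ha C.da nda
  have c5 : Col G {x | x = h ∨ (¬ G.Adj x h ∧ ¬ G.Adj x e ∧ ¬ G.Adj x b)} 1 := by
    apply Col.stable
    rintro x (rfl | hx) y (rfl | hy) hxy
    · exact G.irrefl hxy
    · exact hy.1 hxy.symm
    · exact hx.1 hxy
    · exact cls e b he hb C.eb neb x y hx.1 hy.1 hx.2.1 hx.2.2 hy.2.1 hy.2.2 hxy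
  refine (c1.union (c2.union (c3.union (c4.union c5)))).mono ?_ (by norm_num)
  intro x hx
  simp only [Set.mem_union, Set.mem_ofPred_eq] at hx ⊢
  tauto

/-- Every vertex is in one of the classes. -/
lemma cover (W : WFree G) (C : IsC5 G a b c d e) (hh : Hub G a b c d e h) (x : V) :
    (x = h ∨ x = a ∨ x = b ∨ x = c ∨ x = d ∨ x = e ∨ (¬ G.Adj x h ∧
      ((¬ G.Adj x a ∧ ¬ G.Adj x c) ∨ (¬ G.Adj x b ∧ ¬ G.Adj x d) ∨ (¬ G.Adj x c ∧ ¬ G.Adj x e) ∨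
      (¬ G.Adj x d ∧ ¬ G.Adj x a) ∨ (¬ G.Adj x e ∧ ¬ G.Adj x b)))) ∨
    (x ≠ h ∧ Hub G a b c d e x) ∨ AnyTT G a b c d e x ∨
    (G.Adj x h ∧ AnySub2 G a b c d e x) := by
  by_cases e0 : x = h
  · tauto
  by_cases e1 : x = a
  · tauto
  by_cases e2 : x = b
  · tauto
  by_cases e3 : x = c
  · tauto
  by_cases e4 : x = d
  · tauto
  by_cases e5 : x = e
  · tauto
  by_cases hx : G.Adj x h
  · have m1 := mid_adj W C hh e1 hx
    have m2 := mid_adj W C.rot hh.rot e2 hx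
    have m3 := mid_adj W C.rot.rot hh.rot.rot e3 hx
    have m4 := mid_adj W C.rot.rot.rot hh.rot.rot.rot e4 hx
    have m5 := mid_adj W C.rot.rot.rot.rot hh.rot.rot.rot.rot e5 hx
    right
    unfold Hub AnyTT AnySub2 TT Sub2
    by_cases p1 : G.Adj x a <;> by_cases p2 : G.Adj x b <;> by_cases p3 : G.Adj x c <;>
    by_cases p4 : G.Adj x d <;> by_cases p5 : G.Adj x e <;>
    simp_all
  · have m1 := fun t1 t2 t3 => hx (three_adj W C hh e0 t1 t2 t3)
    have m2 := fun t1 t2 t3 => hx (three_adj W C.rot hh.rot e0 t1 t2 t3)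
    have m3 := fun t1 t2 t3 => hx (three_adj W C.rot.rot hh.rot.rot e0 t1 t2 t3)
    have m4 := fun t1 t2 t3 => hx (three_adj W C.rot.rot.rot hh.rot.rot.rot e0 t1 t2 t3)
    have m5 := fun t1 t2 t3 => hx (three_adj W C.rot.rot.rot.rot hh.rot.rot.rot.rot e0 t1 t2 t3)
    left
    by_cases p1 : G.Adj x a <;> by_cases p2 : G.Adj x b <;> by_cases p3 : G.Adj x c <;>
    by_cases p4 : G.Adj x d <;> by_cases p5 : G.Adj x e <;>
    simp_all

lemma main_col [Finite V] (P : PFree G) (W : WFree G) (C : IsC5 G a b c d e)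
    (hh : Hub G a b c d e h) (hω : 5 ≤ G.cliqueNum) : Col G Set.univ (2 * G.cliqueNum) := by
  set H : Set V := {x | Hub G a b c d e x} with hHdef
  set T : Set V := {x | AnyTT G a b c d e x} with hTdef
  set X : Set V := {x | G.Adj x h ∧ AnySub2 G a b c d e x} with hXdef
  have hH : ∀ x ∈ H, Hub G a b c d e x := fun x hx => hx
  have hhH : h ∈ H := hh
  have hk : 1 ≤ H.ncard := by
    exact (Set.ncard_pos (Set.toFinite H)).2 ⟨h, hh⟩
  have hb := single_bound W C hH
  obtain ⟨m, hm⟩ : ∃ m, m + (H.ncard + 2) = G.cliqueNum :=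
    ⟨G.cliqueNum - (H.ncard + 2), by omega⟩
  have hR : Col G (T ∪ X) (2 * m + H.ncard) := by
    by_cases hE : ∀ x ∈ X, ¬ (G.Adj x a ∧ G.Adj x b) ∧ ¬ (G.Adj x b ∧ G.Adj x c) ∧
      ¬ (G.Adj x c ∧ G.Adj x d) ∧ ¬ (G.Adj x d ∧ G.Adj x e) ∧ ¬ (G.Adj x e ∧ G.Adj x a)
    · exact case_noedge P W C hH hhH (fun x hx => hx) (fun x hx => hx) hE hm hω
    · obtain ⟨x, hx, hx'⟩ : ∃ x ∈ X, (G.Adj x a ∧ G.Adj x b) ∨ (G.Adj x b ∧ G.Adj x c) ∨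
        (G.Adj x c ∧ G.Adj x d) ∨ (G.Adj x d ∧ G.Adj x e) ∨ (G.Adj x e ∧ G.Adj x a) := by
        by_contra hcon
        apply hE
        intro x hx
        have := fun t => hcon ⟨x, hx, t⟩
        tauto
      have hs := hx.2
      rcases hx' with h1 | h1 | h1 | h1 | h1
      · exact case_edge P W C hH hhH (fun x hx => hx) (fun x hx => hx) hx.1 h1.1 h1.2
          (by unfold AnySub2 Sub2 at *; tauto) hm
      · exact case_edge P W C.rot (fun x hx => (hH x hx).rot) hhH (fun x hx => ⟨hx.1, hx.2.rot⟩)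
          (fun x hx => AnyTT.rot hx) hx.1 h1.1 h1.2
          (by unfold AnySub2 Sub2 at *; tauto) hm
      · exact case_edge P W C.rot.rot (fun x hx => (hH x hx).rot.rot) hhH
          (fun x hx => ⟨hx.1, hx.2.rot.rot⟩)
          (fun x hx => (AnyTT.rot hx).rot) hx.1 h1.1 h1.2
          (by unfold AnySub2 Sub2 at *; tauto) hm
      · exact case_edge P W C.rot.rot.rot (fun x hx => (hH x hx).rot.rot.rot) hhH
          (fun x hx => ⟨hx.1, hx.2.rot.rot.rot⟩)
          (fun x hx => (AnyTT.rot hx).rot.rot) hx.1 h1.1 h1.2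
          (by unfold AnySub2 Sub2 at *; tauto) hm
      · exact case_edge P W C.rot.rot.rot.rot (fun x hx => (hH x hx).rot.rot.rot.rot) hhH
          (fun x hx => ⟨hx.1, hx.2.rot.rot.rot.rot⟩)
          (fun x hx => (AnyTT.rot hx).rot.rot.rot) hx.1 h1.1 h1.2
          (by unfold AnySub2 Sub2 at *; tauto) hm
  have hHh : Col G (H \ {h}) (H.ncard - 1) := by
    have := Col.card (G := G) (H \ {h})
    rwa [Set.ncard_sdiff_singleton_of_mem hhH] at this
  refine ((base_col P C hh).union (hHh.union hR)).mono ?_ (by omega)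
  intro x _
  rcases cover W C hh x with hx | hx | hx | hx
  · exact Or.inl hx
  · exact Or.inr (Or.inl ⟨hx.2, hx.1⟩)
  · exact Or.inr (Or.inr (Or.inl hx))
  · exact Or.inr (Or.inr (Or.inr hx))

end

end PW

theorem stmt2 {V : Type*} [Fintype V] (G : SimpleGraph V)
    (hP : IsEmpty (P3P2 ↪g G)) (hW : IsEmpty (W4 ↪g G)) (hω : 5 ≤ G.cliqueNum)
    (hW5 : Nonempty (W5 ↪g G)) :
    G.chromaticNumber ≤ (2 * G.cliqueNum : ℕ∞) := by
  obtain ⟨f⟩ := hW5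
  have hadj : ∀ i j : Fin 6, G.Adj (f i) (f j) ↔ W5.Adj i j := fun i j => f.map_rel_iff
  have C : PW.IsC5 G (f 0) (f 1) (f 2) (f 3) (f 4) := by
    constructor <;> rw [hadj] <;> simp [W5]
  have hh : PW.Hub G (f 0) (f 1) (f 2) (f 3) (f 4) (f 5) := by
    refine ⟨?_, ?_, ?_, ?_, ?_⟩ <;> rw [hadj] <;> simp [W5]
  have := (PW.main_col (PW.pfree hP) (PW.wfree hW) C hh hω).colorable.chromaticNumber_le
  exact_mod_cast this
end

section
/- Let G be a finite simple graph that is (P3∪P2)-free, W4-free and W5-free, with ω(G) ≥ 5. If G contains an induced subgraph isomorphic to P2∪K3 (the disjoint union of an edge and a triangle), then χ(G) ≤ 2·ω(G). -/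
open SimpleGraph

/-- `P2 ∪ K3`: disjoint union of an edge (0-1) and a triangle (2,3,4). -/
def P2K3 : SimpleGraph (Fin 5) :=
  SimpleGraph.fromEdgeSet {s(0,1), s(2,3), s(3,4), s(2,4)}

section helpers

variable {V : Type*} {G : SimpleGraph V}

theorem emb_of_pattern {n : ℕ} {H : SimpleGraph (Fin n)} (hH : IsEmpty (H ↪g G)) (f : Fin n → V)
    (hadj : ∀ i j, i < j → (G.Adj (f i) (f j) ↔ H.Adj i j))
    (hne : ∀ i j, i < j → f i ≠ f j) : False := by
  refine hH.false ⟨⟨f, ?_⟩, ?_⟩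
  · intro i j hij
    rcases lt_trichotomy i j with h | h | h
    · exact absurd hij (hne i j h)
    · exact h
    · exact absurd hij.symm (hne j i h)
  · intro i j
    rcases lt_trichotomy i j with h | h | h
    · exact hadj i j h
    · subst h; simp
    · rw [G.adj_comm, H.adj_comm]; exact hadj j i h

theorem noP3P2 (hP : IsEmpty (P3P2 ↪g G)) (a b c d e : V) (hab : G.Adj a b) (hbc : G.Adj b c)
    (hac : a ≠ c) (nac : ¬ G.Adj a c) (hde : G.Adj d e)
    (h1 : ¬ G.Adj a d) (h2 : ¬ G.Adj a e) (h3 : ¬ G.Adj b d) (h4 : ¬ G.Adj b e)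
    (h5 : ¬ G.Adj c d) (h6 : ¬ G.Adj c e) : False := by
  have n1 : a ≠ b := hab.ne
  have n2 : b ≠ c := hbc.ne
  have n3 : d ≠ e := hde.ne
  have n4 : a ≠ d := by rintro rfl; exact h2 hde
  have n5 : a ≠ e := by rintro rfl; exact h1 hde.symm
  have n6 : b ≠ d := by rintro rfl; exact h4 hde
  have n7 : b ≠ e := by rintro rfl; exact h3 hde.symm
  have n8 : c ≠ d := by rintro rfl; exact h6 hde
  have n9 : c ≠ e := by rintro rfl; exact h5 hde.symm
  refine emb_of_pattern hP ![a, b, c, d, e] ?_ ?_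
  · intro i j hij
    fin_cases i <;> fin_cases j <;> first | (exact absurd hij (by decide)) | simp [P3P2, *]
  · intro i j hij
    fin_cases i <;> fin_cases j <;> first | (exact absurd hij (by decide)) | simp [*]

theorem noW4 (hW : IsEmpty (W4 ↪g G)) (a b c d h : V) (hab : G.Adj a b) (hbc : G.Adj b c)
    (hcd : G.Adj c d) (hda : G.Adj d a) (nac : a ≠ c) (nbd : b ≠ d)
    (hac : ¬ G.Adj a c) (hbd : ¬ G.Adj b d)
    (h1 : G.Adj h a) (h2 : G.Adj h b) (h3 : G.Adj h c) (h4 : G.Adj h d) : False := by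
  have e1 := hda.symm
  have e2 := h1.symm
  have e3 := h2.symm
  have e4 := h3.symm
  have e5 := h4.symm
  have n1 := hab.ne
  have n2 := hbc.ne
  have n3 := hcd.ne
  have n4 := e1.ne
  have n5 := e2.ne
  have n6 := e3.ne
  have n7 := e4.ne
  have n8 := e5.ne
  refine emb_of_pattern hW ![a, b, c, d, h] ?_ ?_
  · intro i j hij
    fin_cases i <;> fin_cases j <;> first | (exact absurd hij (by decide)) | simp [W4, *]
  · intro i j hij
    fin_cases i <;> fin_cases j <;> first | (exact absurd hij (by decide)) | simp [*]

/-- Induced 5-cycle on the listed vertices. -/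
def IsC5 (G : SimpleGraph V) (a b c d e : V) : Prop :=
  G.Adj a b ∧ G.Adj b c ∧ G.Adj c d ∧ G.Adj d e ∧ G.Adj e a ∧
  ¬ G.Adj a c ∧ ¬ G.Adj b d ∧ ¬ G.Adj c e ∧ ¬ G.Adj d a ∧ ¬ G.Adj e b

theorem noW5 (hW : IsEmpty (W5 ↪g G)) (a b c d e h : V) (hc : IsC5 G a b c d e)
    (h1 : G.Adj h a) (h2 : G.Adj h b) (h3 : G.Adj h c) (h4 : G.Adj h d) (h5 : G.Adj h e) :
    False := by
  obtain ⟨c1, c2, c3, c4, c5, m1, m2, m3, m4, m5⟩ := hc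
  have e1 := c5.symm
  have e2 := h1.symm
  have e3 := h2.symm
  have e4 := h3.symm
  have e5 := h4.symm
  have e6 := h5.symm
  have m4' : ¬ G.Adj a d := fun h => m4 h.symm
  have m5' : ¬ G.Adj b e := fun h => m5 h.symm
  have n1 := c1.ne
  have n2 := c2.ne
  have n3 := c3.ne
  have n4 := c4.ne
  have n5 := e1.ne
  have n6 := e2.ne
  have n7 := e3.ne
  have n8 := e4.ne
  have n9 := e5.ne
  have n10 := e6.ne
  have k1 : a ≠ c := by rintro rfl; exact m4 c3.symm
  have k2 : a ≠ d := by rintro rfl; exact m1 c3.symm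
  have k3 : b ≠ d := by rintro rfl; exact m4 c1.symm
  have k4 : b ≠ e := by rintro rfl; exact m2 c4.symm
  have k5 : c ≠ e := by rintro rfl; exact m1 c5.symm
  refine emb_of_pattern hW ![a, b, c, d, e, h] ?_ ?_
  · intro i j hij
    fin_cases i <;> fin_cases j <;> first | (exact absurd hij (by decide)) | simp [W5, *]
  · intro i j hij
    fin_cases i <;> fin_cases j <;> first | (exact absurd hij (by decide)) | simp [*]

/-- `S` can be properly coloured with `k` colours. -/
def Col (G : SimpleGraph V) (S : Finset V) (k : ℕ) : Prop :=
  ∃ c : V → ℕ, (∀ v ∈ S, c v < k) ∧ ∀ u ∈ S, ∀ v ∈ S, G.Adj u v → c u ≠ c v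

/-- Cut-style connectivity of `X`. -/
def Conn (G : SimpleGraph V) (X : Finset V) : Prop :=
  ∀ T ⊆ X, T.Nonempty → T ≠ X → ∃ t ∈ T, ∃ x ∈ X, x ∉ T ∧ G.Adj t x

/-- The induced-subgraph conditions on `S`: no induced `P3 ∪ P2`, `C4`, `C5`. -/
structure Nice (G : SimpleGraph V) (S : Finset V) : Prop where
  p : ∀ a b c d e : V, G.Adj a b → G.Adj b c → a ≠ c → ¬ G.Adj a c → G.Adj d e →
    ¬ G.Adj a d → ¬ G.Adj a e → ¬ G.Adj b d → ¬ G.Adj b e → ¬ G.Adj c d → ¬ G.Adj c e → False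
  c4 : ∀ a ∈ S, ∀ b ∈ S, ∀ c ∈ S, ∀ d ∈ S, G.Adj a b → G.Adj b c → G.Adj c d → G.Adj d a →
    a ≠ c → b ≠ d → ¬ G.Adj a c → ¬ G.Adj b d → False
  c5 : ∀ a ∈ S, ∀ b ∈ S, ∀ c ∈ S, ∀ d ∈ S, ∀ e ∈ S, IsC5 G a b c d e → False

/-- Induced 6-cycle. -/
def IsC6 (G : SimpleGraph V) (a b c d e f : V) : Prop :=
  G.Adj a b ∧ G.Adj b c ∧ G.Adj c d ∧ G.Adj d e ∧ G.Adj e f ∧ G.Adj f a ∧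
  ¬ G.Adj a c ∧ ¬ G.Adj b d ∧ ¬ G.Adj c e ∧ ¬ G.Adj d f ∧ ¬ G.Adj e a ∧ ¬ G.Adj f b ∧
  ¬ G.Adj a d ∧ ¬ G.Adj b e ∧ ¬ G.Adj c f

theorem Nice.mono {S T : Finset V} (h : Nice G S) (hT : T ⊆ S) : Nice G T :=
  ⟨h.p, fun a ha b hb c hc d hd => h.c4 a (hT ha) b (hT hb) c (hT hc) d (hT hd),
    fun a ha b hb c hc d hd e he => h.c5 a (hT ha) b (hT hb) c (hT hc) d (hT hd) e (hT he)⟩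

/-- The separator argument: two neighbours of a connected set `X`, having a common neighbour `y`
with no neighbours in `X`, are adjacent. -/
theorem sep_clique [DecidableEq V] {S X : Finset V} (h : Nice G S)
    (h6 : ∀ a ∈ S, ∀ b ∈ S, ∀ c ∈ S, ∀ d ∈ S, ∀ e ∈ S, ∀ f ∈ S, ¬ IsC6 G a b c d e f)
    (hX : X ⊆ S) (hc : Conn G X) {s t y : V} (hs : s ∈ S) (ht : t ∈ S) (hy : y ∈ S)
    (hsy : G.Adj s y) (hty : G.Adj t y) (hyX : ∀ x ∈ X, ¬ G.Adj y x)
    (hsX : ∃ x ∈ X, G.Adj s x) (htX : ∃ x ∈ X, G.Adj t x)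
    (hyn : y ∉ X) (hst : s ≠ t) : G.Adj s t := by
  classical
  by_contra hn
  have sym := fun a b => G.adj_comm a b
  -- no common neighbour
  have H1 : ∀ x ∈ X, G.Adj s x → ¬ G.Adj t x := by
    intro x hx h1 h2
    exact h.c4 s hs x (hX hx) t ht y hy h1 h2.symm hty hsy.symm hst
      (by rintro rfl; exact hyn hx) hn (fun h => hyX x hx h.symm)
  have H2 : ∀ x ∈ X, G.Adj s x → ∀ z ∈ X, G.Adj x z → ¬ G.Adj t z := by
    intro x hx h1 z hz h2 h3
    have hsz : ¬ G.Adj s z := fun h => H1 z hz h h3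
    refine h.c5 s hs x (hX hx) z (hX hz) t ht y hy ⟨h1, h2, h3.symm, hty, hsy.symm, hsz,
      fun h => H1 x hx h1 h.symm, fun h => hyX z hz h.symm, fun h => hn h.symm, hyX x hx⟩
  have H3 : ∀ x ∈ X, G.Adj s x → ∀ z ∈ X, G.Adj x z → ∀ w ∈ X, G.Adj z w → ¬ G.Adj t w := by
    intro x hx h1 z hz h2 w hw h3 h4
    have hsz : ¬ G.Adj s z := fun h => H2 z hz h w hw h3 h4
    have hsw : ¬ G.Adj s w := fun h => H1 w hw h h4
    have hxw : ¬ G.Adj x w := fun h => H2 x hx h1 w hw h h4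
    have htx := H1 x hx h1
    have htz := H2 x hx h1 z hz h2
    exact h6 s hs x (hX hx) z (hX hz) w (hX hw) t ht y hy ⟨h1, h2, h3, h4.symm, hty, hsy.symm,
      hsz, hxw, fun h => htz h.symm, fun h => hyX w hw h.symm, fun h => hn h.symm, hyX x hx,
      hsw, fun h => htx h.symm, fun h => hyX z hz h.symm⟩
  obtain ⟨t0, ht0, htt0⟩ := htX
  obtain ⟨x0, hx0, hsx0⟩ := hsX
  set T1 := X.filter (fun x => G.Adj s x) with hT1
  set T2 := X.filter (fun x => G.Adj s x ∨ ∃ z ∈ X, G.Adj s z ∧ G.Adj z x) with hT2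
  have T2ne : T2 ≠ X := by
    intro hE
    have : t0 ∈ T2 := hE ▸ ht0
    rw [hT2, Finset.mem_filter] at this
    rcases this with ⟨_, h1 | ⟨z, hz, h1, h2⟩⟩
    · exact H1 t0 ht0 h1 htt0
    · exact H2 z hz h1 t0 ht0 h2 htt0
  obtain ⟨u, hu, w, hw, hwT, huw⟩ := hc T2 (Finset.filter_subset _ _)
    ⟨x0, by rw [hT2, Finset.mem_filter]; exact ⟨hx0, Or.inl hsx0⟩⟩ T2ne
  have hwT' : ¬ (G.Adj s w ∨ ∃ z ∈ X, G.Adj s z ∧ G.Adj z w) := by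
    intro hh; exact hwT (by rw [hT2, Finset.mem_filter]; exact ⟨hw, hh⟩)
  push Not at hwT'
  obtain ⟨hsw, hzw⟩ := hwT'
  rw [hT2, Finset.mem_filter] at hu
  rcases hu with ⟨huX, h1 | ⟨z, hz, h1, h2⟩⟩
  · exact hzw u huX h1 huw
  · have hxw := hzw z hz h1
    refine h.p z u w t y h2 huw ?_ hxw hty ?_ ?_ ?_ ?_ ?_ ?_
    · rintro rfl; exact hsw h1
    · exact fun h => H1 z hz h1 h.symm
    · exact fun h => hyX z hz h.symm
    · exact fun h => H2 z hz h1 u huX h2 h.symm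
    · exact fun h => hyX u huX h.symm
    · exact fun h => H3 z hz h1 u huX h2 w hw huw h.symm
    · exact fun h => hyX w hw h.symm

theorem Conn.insert [DecidableEq V] {X : Finset V} (hc : Conn G X) {s x : V} (hx : x ∈ X)
    (hsx : G.Adj s x) : Conn G (insert s X) := by
  intro T hT hne hTX
  by_cases hs : s ∈ X
  · rw [Finset.insert_eq_of_mem hs] at *; exact hc T hT hne hTX
  by_cases hsT : s ∈ T
  · by_cases hxT : x ∈ T
    · have h1 : (T.erase s) ≠ X := by
        intro h; apply hTX; rw [← h, Finset.insert_erase hsT]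
      obtain ⟨t, ht, z, hz, hzT, htz⟩ := hc (T.erase s) (by
        intro v hv
        rw [Finset.mem_erase] at hv
        exact (Finset.mem_insert.1 (hT hv.2)).resolve_left hv.1)
        ⟨x, by rw [Finset.mem_erase]; exact ⟨hsx.ne', hxT⟩⟩ h1
      refine ⟨t, Finset.mem_of_mem_erase ht, z, Finset.mem_insert_of_mem hz, ?_, htz⟩
      intro h
      exact hzT (Finset.mem_erase.2 ⟨by rintro rfl; exact hs hz, h⟩)
    · exact ⟨s, hsT, x, Finset.mem_insert_of_mem hx, hxT, hsx⟩
  · have hTX' : T ⊆ X := fun v hv => (Finset.mem_insert.1 (hT hv)).resolve_left (by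
      rintro rfl; exact hsT hv)
    by_cases hxT : x ∈ T
    · exact ⟨x, hxT, s, Finset.mem_insert_self _ _, hsT, hsx.symm⟩
    · obtain ⟨t, ht, z, hz, hzT, htz⟩ := hc T hTX' hne (by rintro rfl; exact hxT hx)
      exact ⟨t, ht, z, Finset.mem_insert_of_mem hz, hzT, htz⟩

/-- A nonempty set without induced cycles has a simplicial vertex. -/
theorem exists_simplicial [DecidableEq V] (n : ℕ) : ∀ S : Finset V, S.card = n → S.Nonempty →
    Nice G S →
    (∀ a ∈ S, ∀ b ∈ S, ∀ c ∈ S, ∀ d ∈ S, ∀ e ∈ S, ∀ f ∈ S, ¬ IsC6 G a b c d e f) →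
    ∃ v ∈ S, ∀ x ∈ S, ∀ y ∈ S, G.Adj v x → G.Adj v y → x ≠ y → G.Adj x y := by
  classical
  induction n using Nat.strong_induction_on with
  | _ n ih =>
  intro S hS hne h h6
  by_cases hcomp : ∀ x ∈ S, ∀ y ∈ S, x ≠ y → G.Adj x y
  · obtain ⟨v, hv⟩ := hne
    exact ⟨v, hv, fun x hx y hy _ _ hxy => hcomp x hx y hy hxy⟩
  push Not at hcomp
  obtain ⟨p, hp, q, hq, hpq, hnpq⟩ := hcomp
  let good : Finset V → Prop := fun X => X.Nonempty ∧ Conn G X ∧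
    ∃ y ∈ S, y ∉ X ∧ ∀ x ∈ X, ¬ G.Adj y x
  have hgp : {p} ∈ S.powerset.filter good := by
    rw [Finset.mem_filter, Finset.mem_powerset]
    refine ⟨by simpa using hp, by simp, ?_, q, hq, by simpa using hpq.symm, ?_⟩
    · intro T hT hTn hTp
      exact absurd ((Finset.subset_singleton_iff.1 hT).resolve_left hTn.ne_empty) hTp
    · intro x hx; rw [Finset.mem_singleton] at hx; subst hx; exact fun h => hnpq h.symm
  obtain ⟨X, hXm, hXmax⟩ := Finset.exists_max_image _ Finset.card ⟨_, hgp⟩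
  rw [Finset.mem_filter, Finset.mem_powerset] at hXm
  obtain ⟨hXS, hXne, hXc, y0, hy0S, hy0X, hy0⟩ := hXm
  set Y := S.filter (fun y => y ∉ X ∧ ∀ x ∈ X, ¬ G.Adj y x) with hY
  have memY : ∀ y, y ∈ Y ↔ y ∈ S ∧ y ∉ X ∧ ∀ x ∈ X, ¬ G.Adj y x := by
    intro y; rw [hY, Finset.mem_filter]
  -- every attachment of X is complete to Y
  have hatt : ∀ s ∈ S, s ∉ X → (∃ x ∈ X, G.Adj s x) → ∀ y ∈ Y, G.Adj s y := by
    intro s hs hsX ⟨x, hx, hsx⟩ y hy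
    by_contra hn
    rw [memY] at hy
    have : insert s X ∈ S.powerset.filter good := by
      rw [Finset.mem_filter, Finset.mem_powerset]
      refine ⟨Finset.insert_subset hs hXS, by simp, hXc.insert hx hsx, y, hy.1, ?_, ?_⟩
      · rw [Finset.mem_insert]; rintro (rfl | h')
        · exact hy.2.2 x hx hsx
        · exact hy.2.1 h'
      · intro z hz
        rcases Finset.mem_insert.1 hz with rfl | hz
        · exact fun h => hn h.symm
        · exact hy.2.2 z hz
    have := hXmax _ this
    rw [Finset.card_insert_of_notMem hsX] at this
    omega
  have hYS : Y ⊆ S := Finset.filter_subset _ _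
  have hYcard : Y.card < n := by
    rw [← hS]
    apply Finset.card_lt_card
    refine ⟨hYS, fun hh => ?_⟩
    obtain ⟨x, hx⟩ := hXne
    exact ((memY x).1 (hh (hXS hx))).2.1 hx
  obtain ⟨v, hv, hvs⟩ := ih _ hYcard Y rfl ⟨y0, (memY y0).2 ⟨hy0S, hy0X, hy0⟩⟩ (h.mono hYS)
    (fun a ha b hb c hc d hd e he f hf =>
      h6 a (hYS ha) b (hYS hb) c (hYS hc) d (hYS hd) e (hYS he) f (hYS hf))
  have hv' := (memY v).1 hv
  -- a neighbour of v is in Y or is an attachment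
  have hcase : ∀ x ∈ S, G.Adj v x → x ∈ Y ∨ (x ∉ X ∧ ∃ z ∈ X, G.Adj x z) := by
    intro x hx hvx
    by_cases hxX : x ∈ X
    · exact absurd hvx (hv'.2.2 x hxX)
    by_cases hh : ∃ z ∈ X, G.Adj x z
    · exact Or.inr ⟨hxX, hh⟩
    · push Not at hh
      exact Or.inl ((memY x).2 ⟨hx, hxX, hh⟩)
  refine ⟨v, hv'.1, ?_⟩
  intro x hx y hy hvx hvy hxy
  rcases hcase x hx hvx with h1 | ⟨h1, h1'⟩ <;> rcases hcase y hy hvy with h2 | ⟨h2, h2'⟩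
  · exact hvs x h1 y h2 hvx hvy hxy
  · exact (hatt y hy h2 h2' x h1).symm
  · exact hatt x hx h1 h1' y h2
  · exact sep_clique h h6 hXS hXc hx hy hv'.1 hvx.symm hvy.symm hv'.2.2 h1' h2' hv'.2.1 hxy

theorem col_chordal [DecidableEq V] (k : ℕ) (n : ℕ) : ∀ S : Finset V, S.card = n → Nice G S →
    (∀ a ∈ S, ∀ b ∈ S, ∀ c ∈ S, ∀ d ∈ S, ∀ e ∈ S, ∀ f ∈ S, ¬ IsC6 G a b c d e f) →
    (∀ K ⊆ S, G.IsClique (K : Set V) → K.card ≤ k) → Col G S k := by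
  classical
  induction n with
  | zero =>
    intro S hS _ _ _
    rw [Finset.card_eq_zero] at hS
    subst hS
    exact ⟨fun _ => 0, by simp, by simp⟩
  | succ n ih =>
    intro S hS h h6 hk
    obtain ⟨v, hv, hvs⟩ := exists_simplicial _ S rfl (Finset.card_pos.1 (by omega)) h h6
    have hsub : S.erase v ⊆ S := Finset.erase_subset _ _
    obtain ⟨c, hc1, hc2⟩ := ih (S.erase v) (by rw [Finset.card_erase_of_mem hv]; omega)
      (h.mono hsub)
      (fun a ha b hb c hc d hd e he f hf =>
        h6 a (hsub ha) b (hsub hb) c (hsub hc) d (hsub hd) e (hsub he) f (hsub hf))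
      (fun K hK => hk K (hK.trans hsub))
    set N := S.filter (fun x => G.Adj v x) with hN
    have hvN : v ∉ N := by simp [hN]
    have hcl : (insert v N).card ≤ k := by
      apply hk
      · exact Finset.insert_subset hv (Finset.filter_subset _ _)
      · rw [Finset.coe_insert, SimpleGraph.isClique_insert]
        refine ⟨?_, ?_⟩
        · intro x hx y hy hxy
          simp only [hN, Finset.coe_filter, Set.mem_ofPred_eq] at hx hy
          exact hvs x hx.1 y hy.1 hx.2 hy.2 hxy
        · intro b hb _
          simp only [hN, Finset.coe_filter, Set.mem_ofPred_eq] at hb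
          exact hb.2
    rw [Finset.card_insert_of_notMem hvN] at hcl
    have : ∃ i ∈ Finset.range k, i ∉ N.image c := by
      apply Finset.exists_mem_notMem_of_card_lt_card
      have := Finset.card_image_le (s := N) (f := c)
      rw [Finset.card_range]; omega
    obtain ⟨i, hi, hiN⟩ := this
    rw [Finset.mem_range] at hi
    have hfree : ∀ x ∈ S, G.Adj v x → c x ≠ i := by
      intro x hx hvx hxi
      exact hiN (Finset.mem_image.2 ⟨x, by rw [hN, Finset.mem_filter]; exact ⟨hx, hvx⟩, hxi⟩)
    refine ⟨Function.update c v i, ?_, ?_⟩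
    · intro x hx
      by_cases hxv : x = v
      · subst hxv; simpa using hi
      · rw [Function.update_of_ne hxv]
        exact hc1 x (Finset.mem_erase.2 ⟨hxv, hx⟩)
    · intro x hx y hy hxy
      by_cases hxv : x = v
      · subst hxv
        rw [Function.update_self, Function.update_of_ne hxy.ne']
        exact (hfree y hy hxy).symm
      · by_cases hyv : y = v
        · subst hyv
          rw [Function.update_self, Function.update_of_ne hxv]
          exact hfree x hx hxy.symm
        · rw [Function.update_of_ne hxv, Function.update_of_ne hyv]
          exact hc2 x (Finset.mem_erase.2 ⟨hxv, hx⟩) y (Finset.mem_erase.2 ⟨hyv, hy⟩) hxy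

theorem IsC6.rot {a b c d e f : V} (h : IsC6 G a b c d e f) : IsC6 G b c d e f a := by
  obtain ⟨h1, h2, h3, h4, h5, h6, m1, m2, m3, m4, m5, m6, k1, k2, k3⟩ := h
  exact ⟨h2, h3, h4, h5, h6, h1, m2, m3, m4, m5, m6, m1, k2, k3, fun h => k1 h.symm⟩

theorem c6_local {S : Finset V} (h : Nice G S) {a b c d e f x : V} (ha : a ∈ S) (hb : b ∈ S)
    (hc : c ∈ S) (hd : d ∈ S) (hx : x ∈ S) (h6 : IsC6 G a b c d e f)
    (hxb : x ≠ b) :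
    (G.Adj x a → G.Adj x c → G.Adj x b) ∧
    (G.Adj x a → G.Adj x d → G.Adj x b ∨ G.Adj x c) ∧
    (G.Adj x a → G.Adj x c ∨ G.Adj x d ∨ G.Adj x e) := by
  obtain ⟨h1, h2, h3, h4, h5, h6, m1, m2, m3, m4, m5, m6, k1, k2, k3⟩ := h6
  refine ⟨?_, ?_, ?_⟩
  · intro hxa hxc
    by_contra hn
    exact h.c4 a ha b hb c hc x hx h1 h2 hxc.symm hxa (by rintro rfl; exact k1 h3) hxb.symm m1
      (fun h => hn h.symm)
  · intro hxa hxd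
    by_contra! hn
    exact h.c5 a ha b hb c hc d hd x hx ⟨h1, h2, h3, hxd.symm, hxa, m1, m2,
      fun h => hn.2 h.symm, fun h => k1 h.symm, hn.1⟩
  · intro hxa
    by_contra! hn
    exact h.p c d e x a h3 h4 (by rintro rfl; exact k3 h5) m3 hxa (fun h => hn.1 h.symm)
      (fun h => m1 h.symm) (fun h => hn.2.1 h.symm) (fun h => k1 h.symm)
      (fun h => hn.2.2 h.symm) m5

theorem c6_all_or_none {S : Finset V} (h : Nice G S) {a b c d e f x : V} (ha : a ∈ S) (hb : b ∈ S)
    (hc : c ∈ S) (hd : d ∈ S) (he : e ∈ S) (hf : f ∈ S) (hx : x ∈ S) (h6 : IsC6 G a b c d e f)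
    (n1 : x ≠ a) (n2 : x ≠ b) (n3 : x ≠ c) (n4 : x ≠ d) (n5 : x ≠ e) (n6 : x ≠ f) :
    (G.Adj x a ∧ G.Adj x b ∧ G.Adj x c ∧ G.Adj x d ∧ G.Adj x e ∧ G.Adj x f) ∨
    (¬ G.Adj x a ∧ ¬ G.Adj x b ∧ ¬ G.Adj x c ∧ ¬ G.Adj x d ∧ ¬ G.Adj x e ∧ ¬ G.Adj x f) := by
  have r1 := h6.rot
  have r2 := r1.rot
  have r3 := r2.rot
  have r4 := r3.rot
  have r5 := r4.rot
  have l0 := c6_local h ha hb hc hd hx h6 n2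
  have l1 := c6_local h hb hc hd he hx r1 n3
  have l2 := c6_local h hc hd he hf hx r2 n4
  have l3 := c6_local h hd he hf ha hx r3 n5
  have l4 := c6_local h he hf ha hb hx r4 n6
  have l5 := c6_local h hf ha hb hc hx r5 n1
  clear r1 r2 r3 r4 r5 h6 h ha hb hc hd he hf hx n1 n2 n3 n4 n5 n6
  generalize G.Adj x a = A at *
  generalize G.Adj x b = B at *
  generalize G.Adj x c = C at *
  generalize G.Adj x d = D at *
  generalize G.Adj x e = E at *
  generalize G.Adj x f = F at *
  by_cases A <;> by_cases B <;> by_cases C <;> by_cases D <;> by_cases E <;> by_cases F <;>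
    simp_all

theorem col_c6 [DecidableEq V] {S : Finset V} (h : Nice G S) {a b c d e f : V} (ha : a ∈ S)
    (hb : b ∈ S) (hc : c ∈ S) (hd : d ∈ S) (he : e ∈ S) (hf : f ∈ S) (h6 : IsC6 G a b c d e f)
    {k : ℕ} (hk : ∀ K ⊆ S, G.IsClique (K : Set V) → K.card ≤ k) : Col G S k := by
  classical
  have key : ∀ x ∈ S, x ≠ a → x ≠ b → x ≠ c → x ≠ d → x ≠ e → x ≠ f → _ :=
    fun x hx => c6_all_or_none h ha hb hc hd he hf hx h6
  set K := S.filter (fun x => G.Adj x a ∧ G.Adj x b ∧ G.Adj x c ∧ G.Adj x d ∧ G.Adj x e ∧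
    G.Adj x f) with hK
  have memK : ∀ x, x ∈ K ↔ x ∈ S ∧ (G.Adj x a ∧ G.Adj x b ∧ G.Adj x c ∧ G.Adj x d ∧ G.Adj x e ∧
    G.Adj x f) := by intro x; rw [hK, Finset.mem_filter]
  obtain ⟨h1, h2, h3, h4, h5, h6', m1, m2, m3, m4, m5, m6, k1, k2, k3⟩ := h6
  have hac : a ≠ c := by rintro rfl; exact k1 h3
  have hKc : G.IsClique (K : Set V) := by
    intro x hx y hy hxy
    rw [Finset.mem_coe, memK] at hx hy
    by_contra hn
    exact h.c4 x hx.1 a ha y hy.1 c hc hx.2.1 hy.2.1.symm hy.2.2.2.1 hx.2.2.2.1.symm hxy hac hn m1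
  have haK : a ∉ insert b K := by
    rw [Finset.mem_insert, memK]; rintro (h | h)
    · exact h1.ne h
    · exact G.irrefl h.2.1
  have hbK : b ∉ K := by rw [memK]; exact fun h => G.irrefl h.2.2.1
  have hcard : K.card + 2 ≤ k := by
    have := hk (insert a (insert b K)) (by
      refine Finset.insert_subset ha (Finset.insert_subset hb (Finset.filter_subset _ _))) (by
      rw [Finset.coe_insert, Finset.coe_insert, SimpleGraph.isClique_insert,
        SimpleGraph.isClique_insert]
      refine ⟨⟨hKc, ?_⟩, ?_⟩
      · intro x hx _
        rw [Finset.mem_coe, memK] at hx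
        exact hx.2.2.1.symm
      · intro x hx _
        rcases hx with rfl | hx
        · exact h1
        · rw [Finset.mem_coe, memK] at hx
          exact hx.2.1.symm)
    rw [Finset.card_insert_of_notMem haK, Finset.card_insert_of_notMem hbK] at this
    omega
  let idx : V → ℕ := fun x => if hx : x ∈ K then (K.equivFin ⟨x, hx⟩).val else 0
  have idx_lt : ∀ x ∈ K, idx x < K.card := by
    intro x hx; simp only [idx, hx, dif_pos]; exact Fin.is_lt _
  have idx_inj : ∀ x ∈ K, ∀ y ∈ K, idx x = idx y → x = y := by
    intro x hx y hy hxy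
    simp only [idx, hx, hy, dif_pos] at hxy
    have := K.equivFin.injective (Fin.ext hxy)
    simpa using this
  refine ⟨fun x => if x ∈ K then 2 + idx x else if x = b ∨ x = d ∨ x = f then 1 else 0, ?_, ?_⟩
  · intro x hx
    dsimp only
    split_ifs with hh
    · have := idx_lt x hh; omega
    · omega
    · omega
  · intro x hx y hy hxy
    have sym : ∀ u v, G.Adj u v → G.Adj v u := fun u v h => h.symm
    have irr : ∀ u, ¬ G.Adj u u := fun u => G.irrefl
    dsimp only
    by_cases hxK : x ∈ K <;> by_cases hyK : y ∈ K
    · simp only [hxK, hyK, if_true]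
      intro hE
      exact hxy.ne (idx_inj x hxK y hyK (by omega))
    · simp only [hxK, hyK, if_true, if_false]
      split_ifs <;> omega
    · simp only [hxK, hyK, if_true, if_false]
      split_ifs <;> omega
    · simp only [hxK, hyK, if_false]
      have kx := key x hx
      have ky := key y hy
      rw [memK] at hxK hyK
      split_ifs with p1 p2 p2
      · exfalso
        clear kx ky key idx_lt idx_inj hk h hKc hcard memK hK
        rcases p1 with rfl | rfl | rfl <;> rcases p2 with rfl | rfl | rfl <;> grind
      · simp
      · simp
      · exfalso
        by_cases q1 : x = a ∨ x = c ∨ x = e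
        · by_cases q2 : y = a ∨ y = c ∨ y = e
          · clear kx ky key idx_lt idx_inj hk h hKc hcard memK hK
            rcases q1 with rfl | rfl | rfl <;> rcases q2 with rfl | rfl | rfl <;> grind
          · rw [not_or, not_or] at p2 q2
            have := ky q2.1 p2.1 q2.2.1 p2.2.1 q2.2.2 p2.2.2
            clear kx ky key idx_lt idx_inj hk h hKc hcard memK hK
            rcases q1 with rfl | rfl | rfl <;> grind
        · rw [not_or, not_or] at p1 q1
          have hx' := kx q1.1 p1.1 q1.2.1 p1.2.1 q1.2.2 p1.2.2
          by_cases q2 : y = a ∨ y = c ∨ y = e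
          · clear kx ky key idx_lt idx_inj hk h hKc hcard memK hK
            rcases q2 with rfl | rfl | rfl <;> grind
          · rw [not_or, not_or] at p2 q2
            have hy' := ky q2.1 p2.1 q2.2.1 p2.2.1 q2.2.2 p2.2.2
            have hx'' := hx'.resolve_left (fun hh => hxK ⟨hx, hh⟩)
            have hy'' := hy'.resolve_left (fun hh => hyK ⟨hy, hh⟩)
            exact h.p a b c x y h1 h2 hac m1 hxy (fun h => hx''.1 h.symm) (fun h => hy''.1 h.symm)
              (fun h => hx''.2.1 h.symm) (fun h => hy''.2.1 h.symm)
              (fun h => hx''.2.2.1 h.symm) (fun h => hy''.2.2.1 h.symm)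

theorem col_nice [DecidableEq V] {S : Finset V} (h : Nice G S) {k : ℕ}
    (hk : ∀ K ⊆ S, G.IsClique (K : Set V) → K.card ≤ k) : Col G S k := by
  by_cases h6 : ∀ a ∈ S, ∀ b ∈ S, ∀ c ∈ S, ∀ d ∈ S, ∀ e ∈ S, ∀ f ∈ S, ¬ IsC6 G a b c d e f
  · exact col_chordal k _ S rfl h h6 hk
  · push Not at h6
    obtain ⟨a, ha, b, hb, c, hc, d, hd, e, he, f, hf, h6⟩ := h6
    exact col_c6 h ha hb hc hd he hf h6 hk

theorem Col.union [DecidableEq V] {S T : Finset V} {k l : ℕ} (hS : Col G S k) (hT : Col G T l) :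
    Col G (S ∪ T) (k + l) := by
  obtain ⟨c1, a1, b1⟩ := hS
  obtain ⟨c2, a2, b2⟩ := hT
  refine ⟨fun x => if x ∈ S then c1 x else k + c2 x, ?_, ?_⟩
  · intro v hv
    dsimp only
    split_ifs with h
    · have := a1 v h; omega
    · have := a2 v ((Finset.mem_union.1 hv).resolve_left h); omega
  · intro u hu v hv huv
    dsimp only
    split_ifs with h h' h'
    · exact b1 u h v h' huv
    · have := a1 u h; omega
    · have := a1 v h'; omega
    · have := b2 u ((Finset.mem_union.1 hu).resolve_left h) v
        ((Finset.mem_union.1 hv).resolve_left h') huv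
      omega

theorem main_col [Fintype V] [DecidableEq V]
    (hP : IsEmpty (P3P2 ↪g G)) (hW : IsEmpty (W4 ↪g G)) (hW5 : IsEmpty (W5 ↪g G))
    (hQ : Nonempty (P2K3 ↪g G)) : Col G Finset.univ (2 * G.cliqueNum) := by
  classical
  obtain ⟨φ⟩ := hQ
  have P := noP3P2 hP
  set w := G.cliqueNum with hw
  have hclq : ∀ K : Finset V, G.IsClique (K : Set V) → K.card ≤ w := fun K hK => hK.card_le_cliqueNum
  have hφ : ∀ i j, G.Adj (φ i) (φ j) ↔ P2K3.Adj i j := fun i j => φ.map_rel_iff'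
  set a := φ 0 with ha
  set b := φ 1 with hb
  have hab : G.Adj a b := by rw [ha, hb, hφ]; simp [P2K3]
  have sym : ∀ u v, G.Adj u v → G.Adj v u := fun u v h => h.symm
  -- M : vertices with no neighbour in {a,b} outside; together with a,b
  set M := Finset.univ.filter (fun x => ¬ G.Adj x a ∧ ¬ G.Adj x b) with hM
  set M' := insert a (insert b M) with hM'
  set C := Finset.univ.filter (fun x => G.Adj x a ∧ G.Adj x b) with hC
  set D := Finset.univ.filter (fun x => (G.Adj x a ∧ ¬ G.Adj x b ∧ x ≠ b) ∨
    (G.Adj x b ∧ ¬ G.Adj x a ∧ x ≠ a)) with hD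
  have memM : ∀ x, x ∈ M ↔ ¬ G.Adj x a ∧ ¬ G.Adj x b := by intro x; simp [hM]
  have memM' : ∀ x, x ∈ M' ↔ x = a ∨ x = b ∨ x ∈ M := by intro x; simp [hM']
  have memC : ∀ x, x ∈ C ↔ G.Adj x a ∧ G.Adj x b := by intro x; simp [hC]
  have memD : ∀ x, x ∈ D ↔ (G.Adj x a ∧ ¬ G.Adj x b ∧ x ≠ b) ∨
    (G.Adj x b ∧ ¬ G.Adj x a ∧ x ≠ a) := by intro x; simp [hD]
  have hcover : (Finset.univ : Finset V) = (M' ∪ C) ∪ D := by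
    ext x
    simp only [Finset.mem_univ, Finset.mem_union, memM', memM, memC, memD, true_iff]
    tauto
  -- M' has no induced P3
  have hM3 : ∀ x ∈ M', ∀ y ∈ M', ∀ z ∈ M', G.Adj x y → G.Adj y z → x ≠ z → ¬ G.Adj x z → False := by
    intro x hx y hy z hz hxy hyz hxz hn
    by_cases hall : x ∈ M ∧ y ∈ M ∧ z ∈ M
    · simp only [memM] at hall
      exact P x y z a b hxy hyz hxz hn hab hall.1.1 hall.1.2 hall.2.1.1 hall.2.1.2 hall.2.2.1
        hall.2.2.2
    · simp only [memM', memM] at hx hy hz hall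
      grind
  have niceM : Nice G M' := by
    refine ⟨P, ?_, ?_⟩
    · intro x hx y hy z hz u hu h1 h2 h3 h4 n1 n2 m1 m2
      exact hM3 x hx y hy z hz h1 h2 n1 m1
    · intro x hx y hy z hz u hu v hv ⟨c1, c2, c3, c4, c5, m1, m2, m3, m4, m5⟩
      exact hM3 x hx y hy z hz c1 c2 (by rintro rfl; exact m4 c3.symm) m1
  obtain ⟨Q, hQm, hQmax⟩ := Finset.exists_max_image
    (M'.powerset.filter (fun K : Finset V => G.IsClique (K : Set V))) Finset.card
    ⟨∅, by simp⟩
  rw [Finset.mem_filter, Finset.mem_powerset] at hQm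
  obtain ⟨hQM', hQc⟩ := hQm
  have colM : Col G M' Q.card := col_nice niceM (fun K hK hKc =>
    hQmax K (by rw [Finset.mem_filter, Finset.mem_powerset]; exact ⟨hK, hKc⟩))
  have hs : 3 ≤ Q.card := by
    have hcard : ({φ 2, φ 3, φ 4} : Finset V).card = 3 := by
      rw [Finset.card_eq_three]
      exact ⟨φ 2, φ 3, φ 4, by simp, by simp, by simp, rfl⟩
    rw [← hcard]
    apply hQmax
    rw [Finset.mem_filter, Finset.mem_powerset]
    constructor
    · intro x hx
      rw [memM', memM]
      simp only [Finset.mem_insert, Finset.mem_singleton] at hx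
      right; right
      rcases hx with rfl | rfl | rfl <;> rw [ha, hb, hφ, hφ] <;> simp [P2K3]
    · have e1 : G.Adj (φ 2) (φ 3) := by rw [hφ]; simp [P2K3]
      have e2 : G.Adj (φ 3) (φ 4) := by rw [hφ]; simp [P2K3]
      have e3 : G.Adj (φ 2) (φ 4) := by rw [hφ]; simp [P2K3]
      intro x hx y hy hxy
      simp only [Finset.coe_insert, Finset.coe_singleton, Set.mem_insert_iff,
        Set.mem_singleton_iff] at hx hy
      rcases hx with rfl | rfl | rfl <;> rcases hy with rfl | rfl | rfl <;>
        first | exact absurd rfl hxy | assumption | (apply sym; assumption)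
  have hQM : Q ⊆ M := by
    have aux : ∀ q ∈ Q, (q = a ∨ q = b) → False := by
      intro q hq hqab
      have hsub : Q ⊆ {a, b} := by
        intro x hx
        by_contra hxn
        simp only [Finset.mem_insert, Finset.mem_singleton, not_or] at hxn
        have hxM := (((memM' x).1 (hQM' hx)).resolve_left hxn.1).resolve_left hxn.2
        rw [memM] at hxM
        rcases hqab with rfl | rfl
        · exact hxM.1 (hQc hx hq hxn.1)
        · exact hxM.2 (hQc hx hq hxn.2)
      have h1 := Finset.card_le_card hsub
      have h2 := Finset.card_le_two (a := a) (b := b)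
      omega
    intro x hx
    rcases (memM' x).1 (hQM' hx) with h | h | h
    · exact (aux x hx (Or.inl h)).elim
    · exact (aux x hx (Or.inr h)).elim
    · exact h
  -- the set C
  have niceC : Nice G C := by
    refine ⟨P, ?_, ?_⟩
    · intro x hx y hy z hz u hu h1 h2 h3 h4 n1 n2 m1 m2
      rw [memC] at hx hy hz hu
      exact noW4 hW x y z u a h1 h2 h3 h4 n1 n2 m1 m2 hx.1.symm hy.1.symm hz.1.symm hu.1.symm
    · intro x hx y hy z hz u hu v hv h5
      rw [memC] at hx hy hz hu hv
      exact noW5 hW5 x y z u v a h5 hx.1.symm hy.1.symm hz.1.symm hu.1.symm hv.1.symm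
  have boundC : ∀ K ⊆ C, G.IsClique (K : Set V) → K.card + 2 ≤ w := by
    intro K hK hKc
    have hbK : b ∉ K := fun h => G.irrefl ((memC b).1 (hK h)).2
    have haK : a ∉ insert b K := by
      rw [Finset.mem_insert]; rintro (h | h)
      · exact hab.ne h
      · exact G.irrefl ((memC a).1 (hK h)).1
    have := hclq (insert a (insert b K)) (by
      rw [Finset.coe_insert, Finset.coe_insert, SimpleGraph.isClique_insert,
        SimpleGraph.isClique_insert]
      refine ⟨⟨hKc, ?_⟩, ?_⟩
      · intro x hx _
        exact ((memC x).1 (hK hx)).2.symm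
      · intro x hx _
        rcases hx with rfl | hx
        · exact hab
        · exact ((memC x).1 (hK hx)).1.symm)
    rw [Finset.card_insert_of_notMem haK, Finset.card_insert_of_notMem hbK] at this
    omega
  have hw2 : 2 ≤ w := by simpa using boundC ∅ (by simp) (by simp)
  have colC : Col G C (w - 2) := col_nice niceC (fun K hK hKc => by
    have := boundC K hK hKc; omega)
  -- vertices of D miss at most one vertex of Q
  have hmiss : ∀ x ∈ D, ∀ q ∈ Q, ∀ q' ∈ Q, ¬ G.Adj x q → ¬ G.Adj x q' → q = q' := by
    intro x hx q hq q' hq' h1 h2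
    by_contra hne
    have hqq := hQc hq hq' hne
    have hqM := (memM q).1 (hQM hq)
    have hqM' := (memM q').1 (hQM hq')
    rcases (memD x).1 hx with ⟨d1, d2, d3⟩ | ⟨d1, d2, d3⟩
    · exact P x a b q q' d1 hab d3 d2 hqq h1 h2 (fun h => hqM.1 h.symm) (fun h => hqM'.1 h.symm)
        (fun h => hqM.2 h.symm) (fun h => hqM'.2 h.symm)
    · exact P x b a q q' d1 hab.symm d3 d2 hqq h1 h2 (fun h => hqM.2 h.symm)
        (fun h => hqM'.2 h.symm) (fun h => hqM.1 h.symm) (fun h => hqM'.1 h.symm)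
  have hDQ : ∀ x ∈ D, x ∉ Q := by
    intro x hx hxQ
    have h1 := (memM x).1 (hQM hxQ)
    have h2 := (memD x).1 hx
    tauto
  have hmiss2 : ∀ x ∈ D, ∀ y ∈ D, G.Adj x y → ∀ q ∈ Q, ∀ q' ∈ Q, ¬ G.Adj x q → ¬ G.Adj y q' →
      q = q' := by
    intro x hx y hy hxy q hq q' hq' h1 h2
    by_contra hne
    obtain ⟨r, hr, hrn⟩ : ∃ r ∈ Q, r ∉ ({q, q'} : Finset V) := by
      apply Finset.exists_mem_notMem_of_card_lt_card
      have := Finset.card_le_two (a := q) (b := q')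
      omega
    simp only [Finset.mem_insert, Finset.mem_singleton, not_or] at hrn
    have a1 : G.Adj x q' := by
      by_contra hh; exact hne (hmiss x hx q hq q' hq' h1 hh)
    have a2 : G.Adj y q := by
      by_contra hh; exact hne (hmiss y hy q hq q' hq' hh h2)
    have a3 : G.Adj x r := by
      by_contra hh; exact hrn.1 (hmiss x hx r hr q hq hh h1)
    have a4 : G.Adj y r := by
      by_contra hh; exact hrn.2 (hmiss y hy r hr q' hq' hh h2)
    exact noW4 hW x y q q' r hxy a2 (hQc hq hq' hne) a1.symm
      (by rintro rfl; exact hDQ _ hx hq) (by rintro rfl; exact hDQ _ hy hq') h1 h2 a3.symm a4.symm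
      (hQc hr hq hrn.1) (hQc hr hq' hrn.2)
  have hcommon : ∀ L : Finset V, L ⊆ D → (∀ x ∈ L, ∀ y ∈ L, ∀ z ∈ L, x ≠ y → y ≠ z → x ≠ z →
      G.Adj x y ∨ G.Adj y z ∨ G.Adj x z) → ∃ q ∈ Q, ∀ x ∈ L, G.Adj q x := by
    intro L hL hind
    by_contra! hno
    obtain ⟨q1, q2, q3, h1, h2, h3, n12, n13, n23⟩ := Finset.two_lt_card_iff.1 (show 2 < Q.card by omega)
    obtain ⟨x1, hx1, m1⟩ := hno q1 h1
    obtain ⟨x2, hx2, m2⟩ := hno q2 h2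
    obtain ⟨x3, hx3, m3⟩ := hno q3 h3
    have m1' : ¬ G.Adj x1 q1 := fun h => m1 h.symm
    have m2' : ¬ G.Adj x2 q2 := fun h => m2 h.symm
    have m3' : ¬ G.Adj x3 q3 := fun h => m3 h.symm
    rcases hind x1 hx1 x2 hx2 x3 hx3
      (by rintro rfl; exact n12 (hmiss _ (hL hx1) _ h1 _ h2 m1' m2'))
      (by rintro rfl; exact n23 (hmiss _ (hL hx2) _ h2 _ h3 m2' m3'))
      (by rintro rfl; exact n13 (hmiss _ (hL hx1) _ h1 _ h3 m1' m3')) with hh | hh | hh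
    · exact n12 (hmiss2 _ (hL hx1) _ (hL hx2) hh _ h1 _ h2 m1' m2')
    · exact n23 (hmiss2 _ (hL hx2) _ (hL hx3) hh _ h2 _ h3 m2' m3')
    · exact n13 (hmiss2 _ (hL hx1) _ (hL hx3) hh _ h1 _ h3 m1' m3')
  have niceD : Nice G D := by
    refine ⟨P, ?_, ?_⟩
    · intro x hx y hy z hz u hu h1 h2 h3 h4 n1 n2 m1 m2
      obtain ⟨q, hq, hqL⟩ := hcommon {x, y, z, u} (by
        intro v hv
        simp only [Finset.mem_insert, Finset.mem_singleton] at hv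
        rcases hv with rfl | rfl | rfl | rfl <;> assumption) (by
        intro p hp q hq r hr
        simp only [Finset.mem_insert, Finset.mem_singleton] at hp hq hr
        have h1' := h1.symm
        have h2' := h2.symm
        have h3' := h3.symm
        have h4' := h4.symm
        rcases hp with rfl | rfl | rfl | rfl <;> rcases hq with rfl | rfl | rfl | rfl <;>
          rcases hr with rfl | rfl | rfl | rfl <;>
          simp only [h1, h2, h3, h4, h1', h2', h3', h4', ne_eq, not_true_eq_false,
            false_imp_iff, imp_true_iff, true_or, or_true])
      exact noW4 hW x y z u q h1 h2 h3 h4 n1 n2 m1 m2 (hqL _ (by simp)) (hqL _ (by simp))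
        (hqL _ (by simp)) (hqL _ (by simp))
    · intro x hx y hy z hz u hu v hv h5
      obtain ⟨q, hq, hqL⟩ := hcommon {x, y, z, u, v} (by
        intro v hv
        simp only [Finset.mem_insert, Finset.mem_singleton] at hv
        rcases hv with rfl | rfl | rfl | rfl | rfl <;> assumption) (by
        intro p hp q hq r hr
        simp only [Finset.mem_insert, Finset.mem_singleton] at hp hq hr
        obtain ⟨h1, h2, h3, h4, h5, -⟩ := h5
        have h1' := h1.symm
        have h2' := h2.symm
        have h3' := h3.symm
        have h4' := h4.symm
        have h5' := h5.symm
        clear hcommon hmiss hmiss2 hclq hQmax hM3 boundC hcover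
        rcases hp with rfl | rfl | rfl | rfl | rfl <;>
          rcases hq with rfl | rfl | rfl | rfl | rfl <;>
          rcases hr with rfl | rfl | rfl | rfl | rfl <;>
          simp only [h1, h2, h3, h4, h5, h1', h2', h3', h4', h5', ne_eq, not_true_eq_false,
            false_imp_iff, imp_true_iff, true_or, or_true])
      exact noW5 hW5 x y z u v q h5 (hqL _ (by simp)) (hqL _ (by simp))
        (hqL _ (by simp)) (hqL _ (by simp)) (hqL _ (by simp))
  have boundD : ∀ K ⊆ D, G.IsClique (K : Set V) → K.card + Q.card ≤ w + 1 := by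
    intro K hK hKc
    obtain ⟨q0, hq0, hall⟩ : ∃ q0 ∈ Q, ∀ x ∈ K, ∀ q ∈ Q, q ≠ q0 → G.Adj x q := by
      by_cases hh : ∃ x ∈ K, ∃ q ∈ Q, ¬ G.Adj x q
      · obtain ⟨x, hx, q, hq, hxq⟩ := hh
        refine ⟨q, hq, fun y hy q' hq' hne => ?_⟩
        by_contra hn
        by_cases hxy : x = y
        · subst hxy; exact hne (hmiss x (hK hx) q' hq' q hq hn hxq)
        · exact hne (hmiss2 x (hK hx) y (hK hy) (hKc hx hy hxy) q hq q' hq' hxq hn).symm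
      · push Not at hh
        obtain ⟨q, hq⟩ : Q.Nonempty := Finset.card_pos.1 (by omega)
        exact ⟨q, hq, fun x hx q' hq' _ => hh x hx q' hq'⟩
    have hdisj : Disjoint K (Q.erase q0) := by
      rw [Finset.disjoint_left]
      intro x hx hxq
      exact hDQ x (hK hx) (Finset.mem_of_mem_erase hxq)
    have := hclq (K ∪ Q.erase q0) (by
      intro x hx y hy hxy
      rw [Finset.mem_coe, Finset.mem_union, Finset.mem_erase] at hx hy
      rcases hx with hx | hx <;> rcases hy with hy | hy
      · exact hKc hx hy hxy
      · exact hall x hx y hy.2 hy.1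
      · exact (hall y hy x hx.2 hx.1).symm
      · exact hQc hx.2 hy.2 hxy)
    rw [Finset.card_union_of_disjoint hdisj, Finset.card_erase_of_mem hq0] at this
    omega
  have colD : Col G D (w + 1 - Q.card) := col_nice niceD (fun K hK hKc => by
    have := boundD K hK hKc; omega)
  have hQw := hclq Q hQc
  have := (colM.union colC).union colD
  rw [← hcover] at this
  obtain ⟨c, c1, c2⟩ := this
  exact ⟨c, fun v hv => lt_of_lt_of_le (c1 v hv) (by omega), c2⟩

end helpers

theorem stmt3 {V : Type*} [Fintype V] (G : SimpleGraph V)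
    (hP : IsEmpty (P3P2 ↪g G)) (hW : IsEmpty (W4 ↪g G)) (hW5 : IsEmpty (W5 ↪g G))
    (hω : 5 ≤ G.cliqueNum) (hQ : Nonempty (P2K3 ↪g G)) :
    G.chromaticNumber ≤ (2 * G.cliqueNum : ℕ∞) := by
  classical
  obtain ⟨c, c1, c2⟩ := main_col hP hW hW5 hQ
  have : G.Colorable (2 * G.cliqueNum) :=
    ⟨SimpleGraph.Coloring.mk (fun v => (⟨c v, c1 v (Finset.mem_univ v)⟩ : Fin _)) (by
      intro u v huv h
      exact c2 u (Finset.mem_univ u) v (Finset.mem_univ v) huv (by simpa using h))⟩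
  exact_mod_cast this.chromaticNumber_le
end

section
/- Let G be a finite simple graph that is (P3∪P2)-free, W4-free and K5-free. If G contains an induced subgraph isomorphic to 2K3 (the disjoint union of two triangles), then χ(G) ≤ 8. -/
open SimpleGraph

/-- `2K3`: disjoint union of two triangles (0,1,2) and (3,4,5). -/
def twoK3 : SimpleGraph (Fin 6) :=
  SimpleGraph.fromEdgeSet {s(0,1), s(1,2), s(0,2), s(3,4), s(4,5), s(3,5)}

/-- A graph in which adjacency is transitive (off the diagonal) and with no clique of size `n+1`
is `n`-colorable. -/
theorem cluster_colorable {W : Type*} [Fintype W] (H : SimpleGraph W) (n : ℕ)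
    (ht : ∀ u v w, H.Adj u v → H.Adj v w → u ≠ w → H.Adj u w)
    (hc : H.CliqueFree (n + 1)) : Nonempty (H.Coloring (Fin n)) := by
  classical
  let r : Setoid W :=
    { r := fun u v => u = v ∨ H.Adj u v
      iseqv := by
        refine ⟨fun _ => Or.inl rfl, ?_, ?_⟩
        · rintro x y (h | h)
          · exact Or.inl h.symm
          · exact Or.inr h.symm
        · rintro x y z (rfl | h) (rfl | h')
          · exact Or.inl rfl
          · exact Or.inr h'
          · exact Or.inr h
          · by_cases hxz : x = z
            · exact Or.inl hxz
            · exact Or.inr (ht _ _ _ h h' hxz) }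
  have key : ∀ q : Quotient r, Nonempty ({v : W // Quotient.mk r v = q} ↪ Fin n) := by
    intro q
    apply Function.Embedding.nonempty_of_card_le
    rw [Fintype.card_fin]
    by_contra hlt
    push Not at hlt
    have h1 : n + 1 ≤ (Finset.univ.filter (fun v : W => Quotient.mk r v = q)).card := by
      rw [Fintype.card_subtype] at hlt
      exact hlt
    obtain ⟨t, hts, htc⟩ := Finset.exists_subset_card_eq h1
    refine hc t ⟨?_, htc⟩
    intro x hx y hy hxy
    have hx' := (Finset.mem_filter.1 (hts hx)).2
    have hy' := (Finset.mem_filter.1 (hts hy)).2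
    rcases (Quotient.exact (hx'.trans hy'.symm) : x = y ∨ H.Adj x y) with h | h
    · exact absurd h hxy
    · exact h
  let e := fun q => (key q).some
  refine ⟨SimpleGraph.Coloring.mk (fun v => e (Quotient.mk r v) ⟨v, rfl⟩) ?_⟩
  intro u v huv heq
  have hq : Quotient.mk r u = Quotient.mk r v := Quotient.sound (Or.inr huv)
  have gen : ∀ (q q' : Quotient r) (hu : Quotient.mk r u = q) (hv : Quotient.mk r v = q'),
      q = q' → e q ⟨u, hu⟩ = e q' ⟨v, hv⟩ → u = v := by
    intro q q' hu hv hqq h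
    subst hqq
    have := (e q).injective h
    simpa using this
  exact huv.ne (gen _ _ rfl rfl hq heq)

theorem noP3P2_s5 {V : Type*} (G : SimpleGraph V) (hP : IsEmpty (P3P2 ↪g G)) (x y z p q : V)
    (hxy : G.Adj x y) (hyz : G.Adj y z) (hxz : ¬ G.Adj x z) (hne : x ≠ z) (hpq : G.Adj p q)
    (hpx : ¬ G.Adj p x) (hpy : ¬ G.Adj p y) (hpz : ¬ G.Adj p z)
    (hqx : ¬ G.Adj q x) (hqy : ¬ G.Adj q y) (hqz : ¬ G.Adj q z) : False := by
  have h1 : p ≠ x := by rintro rfl; exact hqx hpq.symm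
  have h2 : p ≠ y := by rintro rfl; exact hqy hpq.symm
  have h3 : p ≠ z := by rintro rfl; exact hqz hpq.symm
  have h4 : q ≠ x := by rintro rfl; exact hpx hpq
  have h5 : q ≠ y := by rintro rfl; exact hpy hpq
  have h6 : q ≠ z := by rintro rfl; exact hpz hpq
  have h7 := hxy.ne
  have h8 := hyz.ne
  have h9 := hpq.ne
  refine hP.false ⟨⟨![x, y, z, p, q], ?_⟩, ?_⟩
  · intro i j h
    fin_cases i <;> fin_cases j <;> simp_all
  · intro i j
    change G.Adj (![x, y, z, p, q] i) (![x, y, z, p, q] j) ↔ P3P2.Adj i j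
    have s1 := hxy.symm
    have s2 := hyz.symm
    have s3 := hpq.symm
    have s4 : ¬ G.Adj z x := fun h => hxz h.symm
    have s5 : ¬ G.Adj x p := fun h => hpx h.symm
    have s6 : ¬ G.Adj y p := fun h => hpy h.symm
    have s7 : ¬ G.Adj z p := fun h => hpz h.symm
    have s8 : ¬ G.Adj x q := fun h => hqx h.symm
    have s9 : ¬ G.Adj y q := fun h => hqy h.symm
    have s10 : ¬ G.Adj z q := fun h => hqz h.symm
    clear hP
    fin_cases i <;> fin_cases j <;> simp [P3P2, *]

theorem noW4_s5 {V : Type*} (G : SimpleGraph V) (hW : IsEmpty (W4 ↪g G)) (x y z w c : V)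
    (hxy : G.Adj x y) (hyz : G.Adj y z) (hzw : G.Adj z w) (hwx : G.Adj w x)
    (hxz : ¬ G.Adj x z) (hne : x ≠ z) (hyw : ¬ G.Adj y w) (hne' : y ≠ w)
    (hx : G.Adj c x) (hy : G.Adj c y) (hz : G.Adj c z) (hw : G.Adj c w) : False := by
  have h1 := hxy.ne
  have h2 := hyz.ne
  have h3 := hzw.ne
  have h4 := hwx.ne
  have h5 := hx.ne
  have h6 := hy.ne
  have h7 := hz.ne
  have h8 := hw.ne
  refine hW.false ⟨⟨![x, y, z, w, c], ?_⟩, ?_⟩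
  · intro i j h
    fin_cases i <;> fin_cases j <;> simp_all
  · intro i j
    change G.Adj (![x, y, z, w, c] i) (![x, y, z, w, c] j) ↔ W4.Adj i j
    have s1 := hxy.symm
    have s2 := hyz.symm
    have s3 := hzw.symm
    have s4 := hwx.symm
    have s5 := hx.symm
    have s6 := hy.symm
    have s7 := hz.symm
    have s8 := hw.symm
    have s9 : ¬ G.Adj z x := fun h => hxz h.symm
    have s10 : ¬ G.Adj w y := fun h => hyw h.symm
    clear hW
    fin_cases i <;> fin_cases j <;> simp [W4, *]

theorem noK5 {V : Type*} (G : SimpleGraph V) (hK : G.CliqueFree 5) (x y z w c : V)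
    (h1 : G.Adj x y) (h2 : G.Adj x z) (h3 : G.Adj x w) (h4 : G.Adj x c) (h5 : G.Adj y z)
    (h6 : G.Adj y w) (h7 : G.Adj y c) (h8 : G.Adj z w) (h9 : G.Adj z c) (h10 : G.Adj w c) :
    False := by
  classical
  refine hK {x, y, z, w, c} ⟨?_, ?_⟩
  · simp [SimpleGraph.isClique_iff, Set.pairwise_insert_of_symm, G.symm, *]
  · have := h1.ne; have := h2.ne; have := h3.ne; have := h4.ne; have := h5.ne
    have := h6.ne; have := h7.ne; have := h8.ne; have := h9.ne; have := h10.ne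
    simp [Finset.card_insert_of_notMem, *]

/-- `v` misses exactly one vertex of the triangle `a` and exactly one of the triangle `b`. -/
def MissR {V : Type*} (G : SimpleGraph V) (a b : Fin 3 → V) (v : V) : Prop :=
  ∃ i j, (∀ k, G.Adj v (a k) ↔ k ≠ i) ∧ (∀ k, G.Adj v (b k) ↔ k ≠ j)

theorem missR_colorable {V : Type*} [Fintype V] (G : SimpleGraph V)
    (hP : IsEmpty (P3P2 ↪g G)) (hW : IsEmpty (W4 ↪g G)) (hK5 : G.CliqueFree 5)
    (a b : Fin 3 → V) (ha : ∀ i j, i ≠ j → G.Adj (a i) (a j))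
    (hb : ∀ i j, i ≠ j → G.Adj (b i) (b j)) (hab : ∀ i j, ¬ G.Adj (a i) (b j))
    (hab' : ∀ i j, a i ≠ b j) :
    Nonempty ((G.induce {v | MissR G a b v}).Coloring (Fin 2)) := by
  classical
  set H := G.induce {v | MissR G a b v} with hH
  have hadj : ∀ u v : {v | MissR G a b v}, H.Adj u v ↔ G.Adj u v := fun u v => Iff.rfl
  choose i j hi hj using fun v : {v | MissR G a b v} => v.2
  -- adjacent vertices share a row or a column
  have E1 : ∀ u v, H.Adj u v → i u = i v ∨ j u = j v := by
    intro u v huv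
    by_contra hcon
    push Not at hcon
    obtain ⟨h1, h2⟩ := hcon
    obtain ⟨k, hk1, hk2⟩ : ∃ k : Fin 3, k ≠ i u ∧ k ≠ i v := by
      generalize i u = p; generalize i v = q; revert p q; decide
    refine noW4_s5 G hW (a (i u)) (a (i v)) u v (a k) (ha _ _ h1) ?_ huv ?_ ?_ ?_ ?_ ?_
      (ha _ _ hk1) (ha _ _ hk2) ?_ ?_
    · exact ((hi u _).2 h1.symm).symm
    · exact (hi v _).2 h1
    · exact fun h => (hi u _).1 h.symm rfl
    · intro h
      exact hab (i u) (if j u = 0 then 1 else 0) (by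
        rw [h]; rw [hj u]; split_ifs with h0 <;> simp_all [eq_comm])
    · exact fun h => (hi v _).1 h.symm rfl
    · intro h
      exact hab (i v) (if j v = 0 then 1 else 0) (by
        rw [h]; rw [hj v]; split_ifs with h0 <;> simp_all [eq_comm])
    · exact ((hi u _).2 hk1).symm
    · exact ((hi v _).2 hk2).symm
  have E2 : ∀ u w v, H.Adj u w → H.Adj w v → ¬ H.Adj u v → u ≠ v →
      (i u ≠ i w ∧ i w ≠ i v ∧ i u ≠ i v) ∨ (j u ≠ j w ∧ j w ≠ j v ∧ j u ≠ j v) := by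
    intro u w v huw hwv huv hne
    by_contra hcon
    have hk : ∀ p q r : Fin 3, ¬ (p ≠ q ∧ q ≠ r ∧ p ≠ r) → ∃ k, k ≠ p ∧ k ≠ q ∧ k ≠ r := by
      decide
    rw [not_or] at hcon
    obtain ⟨k, k1, k2, k3⟩ := hk _ _ _ hcon.1
    obtain ⟨l, l1, l2, l3⟩ := hk _ _ _ hcon.2
    exact noW4_s5 G hW u (a k) v (b l) w ((hi u _).2 k1) ((hi v _).2 k3).symm ((hj v _).2 l3)
      ((hj u _).2 l1).symm huv (fun h => hne (Subtype.ext h)) (hab _ _) (hab' _ _) huw.symm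
      ((hi w _).2 k2) hwv ((hj w _).2 l2)
  have E3 : ∀ u v w, H.Adj u v → H.Adj v w → H.Adj u w → False := by
    intro u v w huv hvw huw
    have hline : (i u = i v ∧ i v = i w) ∨ (j u = j v ∧ j v = j w) := by
      have h1 := E1 _ _ huv
      have h2 := E1 _ _ hvw
      have h3 := E1 _ _ huw
      grind
    have hk : ∀ p : Fin 3, ∃ k l : Fin 3, k ≠ p ∧ l ≠ p ∧ k ≠ l := by decide
    rcases hline with ⟨h1, h2⟩ | ⟨h1, h2⟩
    · obtain ⟨k, l, hk, hl, hkl⟩ := hk (i w)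
      exact noK5 G hK5 u v w (a k) (a l) huv huw ((hi u _).2 (by rwa [h1, h2]))
        ((hi u _).2 (by rwa [h1, h2])) hvw ((hi v _).2 (by rwa [h2])) ((hi v _).2 (by rwa [h2]))
        ((hi w _).2 hk) ((hi w _).2 hl) (ha _ _ hkl)
    · obtain ⟨k, l, hk, hl, hkl⟩ := hk (j w)
      exact noK5 G hK5 u v w (b k) (b l) huv huw ((hj u _).2 (by rwa [h1, h2]))
        ((hj u _).2 (by rwa [h1, h2])) hvw ((hj v _).2 (by rwa [h2])) ((hj v _).2 (by rwa [h2]))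
        ((hj w _).2 hk) ((hj w _).2 hl) (hb _ _ hkl)
  -- on an induced path the three cells are distinct cells of one line
  have E4 : ∀ u w v, H.Adj u w → H.Adj w v → u ≠ v →
      (i u = i w ∧ i w = i v ∧ j u ≠ j w ∧ j w ≠ j v ∧ j u ≠ j v) ∨
      (j u = j w ∧ j w = j v ∧ i u ≠ i w ∧ i w ≠ i v ∧ i u ≠ i v) := by
    intro u w v huw hwv hne
    have h1 := E1 _ _ huw
    have h2 := E1 _ _ hwv
    have h3 := E2 u w v huw hwv (fun h => E3 _ _ _ huw hwv h) hne
    grind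
  by_cases hp3 : ∀ u v w, H.Adj u v → H.Adj v w → u ≠ w → H.Adj u w
  · apply cluster_colorable H 2 hp3
    intro t ht
    obtain ⟨x, y, z, hxy, hxz, hyz, -⟩ := SimpleGraph.is3Clique_iff.1 ht
    exact E3 x y z hxy hyz hxz
  · push Not at hp3
    obtain ⟨x, y, z, hxy, hyz, hxz, hnxz⟩ := hp3
    have L := E4 x y z hxy hyz hxz
    refine ⟨SimpleGraph.Coloring.mk
      (fun t => if H.Adj t x ∨ H.Adj t z then (0 : Fin 2) else 1) ?_⟩
    have C5 : ∀ p q, H.Adj p q → H.Adj p x → H.Adj q z → False := by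
      intro p q hpq hpx hqz
      have hpz : p ≠ z := by rintro rfl; exact hnxz hpx.symm
      have hqx : q ≠ x := by rintro rfl; exact hnxz hqz
      have hpy : p ≠ y := by rintro rfl; exact E3 _ _ _ hpq hqz hyz
      have hqy : q ≠ y := by rintro rfl; exact E3 _ _ _ hpq hxy.symm hpx
      have L1 := E4 p x y hpx hxy hpy
      have L2 := E4 y z q hyz hqz.symm (Ne.symm hqy)
      have L3 := E4 q p x hpq.symm hpx hqx
      have L4 := E4 z q p hqz.symm hpq.symm (Ne.symm hpz)
      generalize i p = ip at *; generalize i q = iq at *; generalize i x = ix at *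
      generalize i y = iy at *; generalize i z = iz at *
      generalize j p = jp at *; generalize j q = jq at *; generalize j x = jx at *
      generalize j y = jy at *; generalize j z = jz at *
      clear * - L L1 L2 L3 L4
      omega
    intro p q hpq
    by_cases hp : H.Adj p x ∨ H.Adj p z <;> by_cases hq : H.Adj q x ∨ H.Adj q z
    · exfalso
      rcases hp with hp | hp <;> rcases hq with hq | hq
      · exact E3 _ _ _ hpq hq hp
      · exact C5 p q hpq hp hq
      · exact C5 q p hpq.symm hq hp
      · exact E3 _ _ _ hpq hq hp
    · simp [hp, hq]
    · simp [hp, hq]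
    · exfalso
      rw [not_or] at hp hq
      have claw : ∀ p, ¬ H.Adj p x → ¬ H.Adj p z → p ≠ x → p ≠ z → ¬ H.Adj p y := by
        intro p h1 h2 h3 h4 h5
        have L1 := E4 p y x h5 hxy.symm h3
        have L2 := E4 p y z h5 hyz h4
        generalize i p = ip at *; generalize i x = ix at *
        generalize i y = iy at *; generalize i z = iz at *
        generalize j p = jp at *; generalize j x = jx at *
        generalize j y = jy at *; generalize j z = jz at *
        clear * - L L1 L2
        omega
      have hpx : p ≠ x := by rintro rfl; exact hq.1 hpq.symm
      have hpz : p ≠ z := by rintro rfl; exact hq.2 hpq.symm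
      have hqx : q ≠ x := by rintro rfl; exact hp.1 hpq
      have hqz : q ≠ z := by rintro rfl; exact hp.2 hpq
      exact noP3P2_s5 G hP x y z p q hxy hyz hnxz (fun h => hxz (Subtype.ext h)) hpq hp.1
        (claw p hp.1 hp.2 hpx hpz) hp.2 hq.1 (claw q hq.1 hq.2 hqx hqz) hq.2

/-- A vertex meeting the triangle `a` but not complete to it misses at most one vertex of `b`. -/
theorem miss_unique {V : Type*} (G : SimpleGraph V) (hP : IsEmpty (P3P2 ↪g G))
    (a b : Fin 3 → V) (ha : ∀ i j, i ≠ j → G.Adj (a i) (a j))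
    (hb : ∀ i j, i ≠ j → G.Adj (b i) (b j)) (hab : ∀ i j, ¬ G.Adj (a i) (b j))
    (v : V) (hv : ∀ i, v ≠ a i) (k l : Fin 3) (hk : G.Adj v (a k)) (hl : ¬ G.Adj v (a l))
    (p q : Fin 3) (hp : ¬ G.Adj v (b p)) (hq : ¬ G.Adj v (b q)) : p = q := by
  by_contra hpq
  have hkl : k ≠ l := by rintro rfl; exact hl hk
  exact noP3P2_s5 G hP v (a k) (a l) (b p) (b q) hk (ha _ _ hkl) hl (hv l) (hb _ _ hpq)
    (fun h => hp h.symm) (fun h => hab _ _ h.symm) (fun h => hab _ _ h.symm)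
    (fun h => hq h.symm) (fun h => hab _ _ h.symm) (fun h => hab _ _ h.symm)

theorem main_colorable {V : Type*} [Fintype V] (G : SimpleGraph V)
    (hP : IsEmpty (P3P2 ↪g G)) (hW : IsEmpty (W4 ↪g G)) (hK5 : G.CliqueFree 5)
    (a b : Fin 3 → V) (ha : ∀ i j, i ≠ j → G.Adj (a i) (a j))
    (hb : ∀ i j, i ≠ j → G.Adj (b i) (b j)) (hab : ∀ i j, ¬ G.Adj (a i) (b j))
    (hab' : ∀ i j, a i ≠ b j) : G.Colorable 8 := by
  classical
  obtain ⟨c1⟩ := missR_colorable G hP hW hK5 a b ha hb hab hab'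
  let Z : Set V := {v | ¬ (∀ k, G.Adj v (a k)) ∧ ¬ (∀ k, G.Adj v (b k)) ∧ ¬ MissR G a b v}
  have hZ : ∀ v ∈ Z, (∃ k, v = a k) ∨ (∃ k, v = b k) ∨
      ((∀ k, ¬ G.Adj v (a k)) ∧ ∀ k, ¬ G.Adj v (b k)) := by
    rintro v ⟨h1, h2, h3⟩
    by_contra hcon
    push Not at hcon h1 h2
    obtain ⟨hva, hvb, h4⟩ := hcon
    obtain ⟨l, hl⟩ := h1
    obtain ⟨m, hm⟩ := h2
    have hba : ∀ i j, ¬ G.Adj (b i) (a j) := fun i j h => hab _ _ h.symm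
    have main : (∃ k, G.Adj v (a k)) ∧ (∃ k, G.Adj v (b k)) := by
      have hne : ∀ m : Fin 3, m + 1 ≠ m := by decide
      by_cases hA : ∃ k, G.Adj v (a k)
      · refine ⟨hA, ?_⟩
        obtain ⟨k, hk⟩ := hA
        by_contra hB
        push Not at hB
        exact hne m (miss_unique G hP a b ha hb hab v hva k l hk hl _ _ (hB _) (hB _))
      · push Not at hA
        obtain ⟨k, hk⟩ := h4 hA
        exact absurd (miss_unique G hP b a hb ha hba v hvb k m hk hm _ _ (hA _) (hA _)) (hne l)
    obtain ⟨⟨k, hk⟩, ⟨k', hk'⟩⟩ := main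
    refine h3 ⟨l, m, fun p => ⟨?_, ?_⟩, fun p => ⟨?_, ?_⟩⟩
    · rintro h rfl; exact hl h
    · intro hp
      by_contra h
      exact hp (miss_unique G hP b a hb ha hba v hvb k' m hk' hm _ _ h hl)
    · rintro h rfl; exact hm h
    · intro hp
      by_contra h
      exact hp (miss_unique G hP a b ha hb hab v hva k l hk hl _ _ h hm)
  have hZt : ∀ u v w : Z, (G.induce Z).Adj u v → (G.induce Z).Adj v w → u ≠ w →
      (G.induce Z).Adj u w := by
    rintro ⟨u, hu⟩ ⟨v, hv⟩ ⟨w, hw⟩ huv hvw hne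
    have hne' : u ≠ w := fun h => hne (Subtype.ext h)
    change G.Adj u v at huv
    change G.Adj v w at hvw
    change G.Adj u w
    have nbrA : ∀ u ∈ Z, ∀ k, G.Adj u (a k) → ∃ l, u = a l := by
      intro u hu k h
      rcases hZ u hu with h1 | ⟨l, rfl⟩ | h1
      · exact h1
      · exact absurd h.symm (hab _ _)
      · exact absurd h (h1.1 k)
    have nbrB : ∀ u ∈ Z, ∀ k, G.Adj u (b k) → ∃ l, u = b l := by
      intro u hu k h
      rcases hZ u hu with ⟨l, rfl⟩ | h1 | h1
      · exact absurd h (hab _ _)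
      · exact h1
      · exact absurd h (h1.2 k)
    rcases hZ v hv with ⟨k, rfl⟩ | ⟨k, rfl⟩ | ⟨h1, h2⟩
    · obtain ⟨p, rfl⟩ := nbrA u hu k huv
      obtain ⟨q, rfl⟩ := nbrA w hw k hvw.symm
      exact ha _ _ (fun h => hne' (by rw [h]))
    · obtain ⟨p, rfl⟩ := nbrB u hu k huv
      obtain ⟨q, rfl⟩ := nbrB w hw k hvw.symm
      exact hb _ _ (fun h => hne' (by rw [h]))
    · have key : ∀ u ∈ Z, G.Adj u v → ∀ k, ¬ G.Adj u (a k) := by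
        intro u hu huv
        rcases hZ u hu with ⟨k, rfl⟩ | ⟨k, rfl⟩ | h
        · exact absurd huv.symm (h1 k)
        · exact absurd huv.symm (h2 k)
        · exact h.1
      by_contra hn
      have hu' := key u hu huv
      have hw' := key w hw hvw.symm
      exact noP3P2_s5 G hP u v w (a 0) (a 1) huv hvw hn hne' (ha _ _ (by decide))
        (fun h => hu' _ h.symm) (fun h => h1 _ h.symm) (fun h => hw' _ h.symm)
        (fun h => hu' _ h.symm) (fun h => h1 _ h.symm) (fun h => hw' _ h.symm)
  obtain ⟨c2⟩ := cluster_colorable (G.induce Z) 4 hZt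
    (hK5.comap (SimpleGraph.Embedding.induce Z).isContained)
  -- complete vertices form stable sets
  have stab : ∀ a : Fin 3 → V, (∀ i j, i ≠ j → G.Adj (a i) (a j)) → ∀ u v,
      (∀ k, G.Adj u (a k)) → (∀ k, G.Adj v (a k)) → ¬ G.Adj u v := by
    intro a ha u v hu hv huv
    exact noK5 G hK5 u v (a 0) (a 1) (a 2) huv (hu _) (hu _) (hu _) (hv _) (hv _) (hv _)
      (ha _ _ (by decide)) (ha _ _ (by decide)) (ha _ _ (by decide))
  let f : V → Bool ⊕ (Fin 2 ⊕ Fin 4) := fun v =>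
    if h1 : ∀ k, G.Adj v (a k) then Sum.inl true
    else if h2 : ∀ k, G.Adj v (b k) then Sum.inl false
    else if h3 : MissR G a b v then Sum.inr (Sum.inl (c1 ⟨v, h3⟩))
    else Sum.inr (Sum.inr (c2 ⟨v, h1, h2, h3⟩))
  have hf : ∀ {u v}, G.Adj u v → f u ≠ f v := by
    intro u v huv
    simp only [f]
    split_ifs with h1 h2 h3 h4 h5 h6 h7 h8 h9 <;> simp only [ne_eq, reduceCtorEq,
      not_false_eq_true, not_true_eq_false, Sum.inl.injEq, Sum.inr.injEq, Bool.true_eq_false,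
      Bool.false_eq_true]
    all_goals first
      | exact stab a ha u v (by assumption) (by assumption) huv
      | exact stab b hb u v (by assumption) (by assumption) huv
      | exact c1.valid huv
      | exact c2.valid huv
  exact (SimpleGraph.Coloring.mk f hf).colorable

theorem stmt5 {V : Type*} [Fintype V] (G : SimpleGraph V)
    (hP : IsEmpty (P3P2 ↪g G)) (hW : IsEmpty (W4 ↪g G)) (hK5 : G.CliqueFree 5)
    (hQ : Nonempty (twoK3 ↪g G)) :
    G.chromaticNumber ≤ 8 := by
  obtain ⟨e⟩ := hQ
  have hadj : ∀ p q, G.Adj (e p) (e q) ↔ twoK3.Adj p q := fun p q => e.map_adj_iff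
  apply SimpleGraph.Colorable.chromaticNumber_le
  refine main_colorable G hP hW hK5 ![e 0, e 1, e 2] ![e 3, e 4, e 5] ?_ ?_ ?_ ?_
  · intro i j hij
    fin_cases i <;> fin_cases j <;> simp_all [twoK3]
  · intro i j hij
    fin_cases i <;> fin_cases j <;> simp_all [twoK3]
  · intro i j
    have key : ∀ p q : Fin 6, p < 3 → 3 ≤ q → ¬ G.Adj (e p) (e q) := by
      intro p q hp hq h
      rw [hadj] at h
      revert h hp hq
      fin_cases p <;> fin_cases q <;> simp [twoK3]
    fin_cases i <;> fin_cases j <;> exact key _ _ (by decide) (by decide)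
  · intro i j
    fin_cases i <;> fin_cases j <;> simp
end

section
/- Let G be a finite simple graph that is (P3∪P2)-free, W4-free, K5-free and 2K3-free. If G contains an induced subgraph isomorphic to P2∪K4 (the disjoint union of an edge and a complete graph on 4 vertices), then χ(G) ≤ 8. -/
open SimpleGraph

/-- `P2 ∪ K4`: disjoint union of an edge (0-1) and a complete graph on {2,3,4,5}. -/
def P2K4 : SimpleGraph (Fin 6) :=
  SimpleGraph.fromEdgeSet {s(0,1), s(2,3), s(2,4), s(2,5), s(3,4), s(3,5), s(4,5)}


/-- A proper two-colouring on a set inducing maximum degree at most one. -/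
lemma exists_two_col {V : Type*} (G : SimpleGraph V) (S : V → Prop)
    (h : ∀ x y z, S x → S y → S z → G.Adj x y → G.Adj y z → x = z) :
    ∃ f : V → Bool, ∀ x y, S x → S y → G.Adj x y → f x ≠ f y := by
  classical
  obtain ⟨lo, -⟩ := exists_wellFoundedLT V
  refine ⟨fun v => decide (∃ u, S u ∧ u < v ∧ G.Adj u v), ?_⟩
  have key : ∀ x y, S x → S y → G.Adj x y → x < y →
      (∃ u, S u ∧ u < y ∧ G.Adj u y) ∧ ¬ (∃ u, S u ∧ u < x ∧ G.Adj u x) := by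
    intro x y hx hy hxy hlt
    refine ⟨⟨x, hx, hlt, hxy⟩, ?_⟩
    rintro ⟨w, hw, hwx, hadj⟩
    have := h w x y hw hx hy hadj hxy
    subst this
    exact lt_asymm hlt hwx
  intro x y hx hy hxy
  rcases lt_trichotomy x y with hlt | heq | hlt
  · have := key x y hx hy hxy hlt
    simp [this.1, this.2]
  · exact absurd heq hxy.ne
  · have := key y x hy hx hxy.symm hlt
    simp [this.1, this.2]

lemma no_P3P2 {V : Type*} {G : SimpleGraph V} (hP : IsEmpty (P3P2 ↪g G)) (x y z u v : V)
    (hxy : G.Adj x y) (hyz : G.Adj y z) (hne : x ≠ z) (huv : G.Adj u v)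
    (h1 : ¬ G.Adj x u) (h2 : ¬ G.Adj x v) (h3 : ¬ G.Adj y u) (h4 : ¬ G.Adj y v)
    (h5 : ¬ G.Adj z u) (h6 : ¬ G.Adj z v) : G.Adj x z := by
  by_contra hxz
  refine hP.false ⟨⟨![x, y, z, u, v], ?_⟩, ?_⟩
  · have := G.adj_comm
    have := G.loopless
    intro i j hij
    fin_cases i <;> fin_cases j <;> simp at hij ⊢ <;> grind [SimpleGraph.Adj.ne]
  · intro i j
    change G.Adj (![x, y, z, u, v] i) (![x, y, z, u, v] j) ↔ P3P2.Adj i j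
    fin_cases i <;> fin_cases j <;> simp [P3P2] <;> grind [G.adj_comm]

lemma no_W4 {V : Type*} {G : SimpleGraph V} (hW : IsEmpty (W4 ↪g G)) (x y z u v : V)
    (hxy : G.Adj x y) (hyz : G.Adj y z) (hzu : G.Adj z u) (hux : G.Adj u x)
    (h1 : G.Adj v x) (h2 : G.Adj v y) (h3 : G.Adj v z) (h4 : G.Adj v u)
    (hxz : x ≠ z) (hyu : y ≠ u) (h5 : ¬ G.Adj x z) (h6 : ¬ G.Adj y u) : False := by
  refine hW.false ⟨⟨![x, y, z, u, v], ?_⟩, ?_⟩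
  · intro i j hij
    fin_cases i <;> fin_cases j <;> simp at hij ⊢ <;> grind [SimpleGraph.Adj.ne]
  · intro i j
    change G.Adj (![x, y, z, u, v] i) (![x, y, z, u, v] j) ↔ W4.Adj i j
    fin_cases i <;> fin_cases j <;> simp [W4] <;> grind [G.adj_comm]

lemma no_twoK3 {V : Type*} {G : SimpleGraph V} (hT : IsEmpty (twoK3 ↪g G)) (x y z u v w : V)
    (hxy : G.Adj x y) (hyz : G.Adj y z) (hxz : G.Adj x z)
    (huv : G.Adj u v) (hvw : G.Adj v w) (huw : G.Adj u w)
    (h1 : ¬ G.Adj x u) (h2 : ¬ G.Adj x v) (h3 : ¬ G.Adj x w)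
    (h4 : ¬ G.Adj y u) (h5 : ¬ G.Adj y v) (h6 : ¬ G.Adj y w)
    (h7 : ¬ G.Adj z u) (h8 : ¬ G.Adj z v) (h9 : ¬ G.Adj z w) : False := by
  refine hT.false ⟨⟨![x, y, z, u, v, w], ?_⟩, ?_⟩
  · intro i j hij
    fin_cases i <;> fin_cases j <;> simp at hij ⊢ <;> grind [SimpleGraph.Adj.ne, G.adj_comm]
  · intro i j
    change G.Adj (![x, y, z, u, v, w] i) (![x, y, z, u, v, w] j) ↔ twoK3.Adj i j
    fin_cases i <;> fin_cases j <;> simp [twoK3] <;> grind [G.adj_comm]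

lemma no_K5 {V : Type*} {G : SimpleGraph V} (hK : G.CliqueFree 5) (x y z u v : V)
    (h1 : G.Adj x y) (h2 : G.Adj x z) (h3 : G.Adj x u) (h4 : G.Adj x v)
    (h5 : G.Adj y z) (h6 : G.Adj y u) (h7 : G.Adj y v)
    (h8 : G.Adj z u) (h9 : G.Adj z v) (h10 : G.Adj u v) : False := by
  classical
  refine hK {x, y, z, u, v} ?_
  rw [SimpleGraph.isNClique_iff]
  constructor
  · intro i hi j hj hij
    simp at hi hj
    grind [G.adj_comm]
  · grind [SimpleGraph.Adj.ne]

/-- The vertex `x` misses the three vertices `q r s` of a `K4` and is adjacent to `p`. -/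
lemma no_single {V : Type*} {G : SimpleGraph V} (hP : IsEmpty (P3P2 ↪g G))
    (hT : IsEmpty (twoK3 ↪g G)) (a b p q r s x : V) (hab : G.Adj a b)
    (hpq : G.Adj p q)
    (hqr : G.Adj q r) (hqs : G.Adj q s) (hrs : G.Adj r s)
    (ha : ¬ G.Adj a p ∧ ¬ G.Adj a q ∧ ¬ G.Adj a r ∧ ¬ G.Adj a s)
    (hb : ¬ G.Adj b p ∧ ¬ G.Adj b q ∧ ¬ G.Adj b r ∧ ¬ G.Adj b s)
    (hx : G.Adj x p) (hxq : ¬ G.Adj x q) (hxr : ¬ G.Adj x r) (hxs : ¬ G.Adj x s)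
    (hne : x ≠ q) : False := by
  have c := G.adj_comm
  have hxa : x ≠ a := by grind
  have hxb : x ≠ b := by grind
  have t := no_twoK3 hT x a b q r s
  have e1 := no_P3P2 hP x a b q r
  have e2 := no_P3P2 hP x b a q r
  have e3 := no_P3P2 hP x p q a b
  grind

/-- Neighbours outside the clique cannot cross on it. -/
lemma no_cross {V : Type*} {G : SimpleGraph V} (hW : IsEmpty (W4 ↪g G))
    (p q r x y : V) (hpq : G.Adj p q) (hpr : G.Adj p r) (hqr : G.Adj q r)
    (hxy : G.Adj x y) (hxp : G.Adj x p) (hyq : G.Adj y q) (hxr : G.Adj x r) (hyr : G.Adj y r)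
    (hxq : ¬ G.Adj x q) (hyp : ¬ G.Adj y p) (hne : x ≠ q) (hne' : y ≠ p) : False := by
  have c := G.adj_comm
  exact no_W4 hW x p q y r hxp hpq hyq.symm hxy.symm hxr.symm hpr.symm hqr.symm hyr.symm hne
    hne'.symm hxq (by grind)

set_option maxHeartbeats 1000000 in
theorem stmt6 {V : Type*} [Fintype V] (G : SimpleGraph V)
    (hP : IsEmpty (P3P2 ↪g G)) (hW : IsEmpty (W4 ↪g G)) (hK5 : G.CliqueFree 5)
    (h2K3 : IsEmpty (twoK3 ↪g G)) (hQ : Nonempty (P2K4 ↪g G)) :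
    G.chromaticNumber ≤ 8 := by
  classical
  obtain ⟨φ⟩ := hQ
  have hadj : ∀ i j, G.Adj (φ i) (φ j) ↔ P2K4.Adj i j := fun i j => φ.map_rel_iff
  obtain ⟨a, ha⟩ : ∃ a, a = φ 0 := ⟨_, rfl⟩
  obtain ⟨b, hb⟩ : ∃ a, a = φ 1 := ⟨_, rfl⟩
  obtain ⟨p, hp⟩ : ∃ a, a = φ 2 := ⟨_, rfl⟩
  obtain ⟨q, hq⟩ : ∃ a, a = φ 3 := ⟨_, rfl⟩
  obtain ⟨r, hr⟩ : ∃ a, a = φ 4 := ⟨_, rfl⟩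
  obtain ⟨s, hs⟩ : ∃ a, a = φ 5 := ⟨_, rfl⟩
  have hab : G.Adj a b := by rw [ha, hb, hadj]; simp [P2K4]
  have hpq : G.Adj p q := by rw [hp, hq, hadj]; simp [P2K4]
  have hpr : G.Adj p r := by rw [hp, hr, hadj]; simp [P2K4]
  have hps : G.Adj p s := by rw [hp, hs, hadj]; simp [P2K4]
  have hqr : G.Adj q r := by rw [hq, hr, hadj]; simp [P2K4]
  have hqs : G.Adj q s := by rw [hq, hs, hadj]; simp [P2K4]
  have hrs : G.Adj r s := by rw [hr, hs, hadj]; simp [P2K4]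
  have na : ¬ G.Adj a p ∧ ¬ G.Adj a q ∧ ¬ G.Adj a r ∧ ¬ G.Adj a s := by
    rw [ha, hp, hq, hr, hs, hadj, hadj, hadj, hadj]; simp [P2K4]
  have nb : ¬ G.Adj b p ∧ ¬ G.Adj b q ∧ ¬ G.Adj b r ∧ ¬ G.Adj b s := by
    rw [hb, hp, hq, hr, hs, hadj, hadj, hadj, hadj]; simp [P2K4]
  clear ha hb hp hq hr hs hadj φ
  have c := G.adj_comm
  have irr : ∀ x, ¬ G.Adj x x := fun x => G.irrefl
  -- no vertex has exactly one neighbour in the clique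
  have hs1 : ∀ x, G.Adj x p → ¬ G.Adj x q → ¬ G.Adj x r → ¬ G.Adj x s → False :=
    fun x h1 h2 h3 h4 => no_single hP h2K3 a b p q r s x hab hpq hqr hqs hrs (by tauto) (by tauto)
      h1 h2 h3 h4 (by grind)
  have hs2 : ∀ x, ¬ G.Adj x p → G.Adj x q → ¬ G.Adj x r → ¬ G.Adj x s → False :=
    fun x h1 h2 h3 h4 => no_single hP h2K3 a b q p r s x hab hpq.symm hpr hps hrs
      (by tauto) (by tauto) h2 h1 h3 h4 (by grind)
  have hs3 : ∀ x, ¬ G.Adj x p → ¬ G.Adj x q → G.Adj x r → ¬ G.Adj x s → False :=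
    fun x h1 h2 h3 h4 => no_single hP h2K3 a b r p q s x hab hpr.symm hpq hps hqs
      (by tauto) (by tauto) h3 h1 h2 h4 (by grind)
  have hs4 : ∀ x, ¬ G.Adj x p → ¬ G.Adj x q → ¬ G.Adj x r → G.Adj x s → False :=
    fun x h1 h2 h3 h4 => no_single hP h2K3 a b s p q r x hab hps.symm hpq hpr hqr
      (by tauto) (by tauto) h4 h1 h2 h3 (by grind)
  have hs5 : ∀ x, G.Adj x p → G.Adj x q → G.Adj x r → G.Adj x s → False :=
    fun x h1 h2 h3 h4 => no_K5 hK5 x p q r s h1 h2 h3 h4 hpq hpr hps hqr hqs hrs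
  -- crossing lemma for arbitrary distinct clique vertices
  have cross : ∀ t u w, (t = p ∨ t = q ∨ t = r ∨ t = s) → (u = p ∨ u = q ∨ u = r ∨ u = s) →
      (w = p ∨ w = q ∨ w = r ∨ w = s) → t ≠ u → t ≠ w → u ≠ w → ∀ x y, G.Adj x y →
      G.Adj x t → G.Adj y u → G.Adj x w → G.Adj y w → ¬ G.Adj x u → ¬ G.Adj y t →
      x ≠ u → y ≠ t → False := by
    intro t u w ht hu hw h1 h2 h3 x y hxy k1 k2 k3 k4 k5 k6 k7 k8
    exact no_cross hW t u w x y (by grind) (by grind) (by grind) hxy k1 k2 k3 k4 k5 k6 k7 k8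
  -- two adjacent vertices with crossing traces on the clique
  have pair : ∀ t u v w, (t = p ∨ t = q ∨ t = r ∨ t = s) → (u = p ∨ u = q ∨ u = r ∨ u = s) →
      (v = p ∨ v = q ∨ v = r ∨ v = s) → (w = p ∨ w = q ∨ w = r ∨ w = s) →
      G.Adj t u → G.Adj v w → ∀ x y z, G.Adj x y → G.Adj y z →
      G.Adj x t → G.Adj x u → G.Adj y t → G.Adj y u → G.Adj z t → G.Adj z u →
      ¬ G.Adj x v → ¬ G.Adj x w → ¬ G.Adj y v → ¬ G.Adj y w → ¬ G.Adj z v → ¬ G.Adj z w →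
      x = z := by
    intro t u v w _ _ _ _ htu hvw x y z hxy hyz a1 a2 a3 a4 a5 a6 b1 b2 b3 b4 b5 b6
    by_contra hne
    have hxz := no_P3P2 hP x y z v w hxy hyz hne hvw b1 b2 b3 b4 b5 b6
    exact no_K5 hK5 x y z t u hxy hxz a1 a2 hyz a3 a4 a5 a6 htu
  obtain ⟨fA, hfA⟩ := exists_two_col G
    (fun x => ¬ G.Adj x p ∧ ¬ G.Adj x q ∧ ¬ G.Adj x r ∧ ¬ G.Adj x s) (by
      rintro x y z ⟨a1, a2, a3, a4⟩ ⟨b1, b2, b3, b4⟩ ⟨c1, c2, c3, c4⟩ hxy hyz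
      by_contra hne
      have hxz := no_P3P2 hP x y z p q hxy hyz hne hpq a1 a2 b1 b2 c1 c2
      exact no_twoK3 h2K3 x y z p q r hxy hyz hxz hpq hqr hpr a1 a2 a3 b1 b2 b3 c1 c2 c3)
  let X : V → Prop := fun x => ¬ G.Adj x s ∧ ((G.Adj x p ∧ G.Adj x q ∧ ¬ G.Adj x r) ∨
    (G.Adj x p ∧ ¬ G.Adj x q ∧ G.Adj x r) ∨ (¬ G.Adj x p ∧ G.Adj x q ∧ G.Adj x r))
  let Y : V → Prop := fun x => G.Adj x s ∧ ((G.Adj x p ∧ ¬ G.Adj x q ∧ ¬ G.Adj x r) ∨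
    (¬ G.Adj x p ∧ G.Adj x q ∧ ¬ G.Adj x r) ∨ (¬ G.Adj x p ∧ ¬ G.Adj x q ∧ G.Adj x r))
  have same : ∀ x y, G.Adj x y → (X x ∧ X y ∨ Y x ∧ Y y) →
      (G.Adj x p ↔ G.Adj y p) ∧ (G.Adj x q ↔ G.Adj y q) ∧ (G.Adj x r ↔ G.Adj y r) := by
    intro x y hxy h
    have e1 := no_cross hW
    simp only [X, Y] at h
    have n1 : x ≠ p ∧ x ≠ q ∧ x ≠ r ∧ x ≠ s := by grind
    have n2 : y ≠ p ∧ y ≠ q ∧ y ≠ r ∧ y ≠ s := by grind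
    have k1 := cross p q r (by simp) (by simp) (by simp) hpq.ne hpr.ne hqr.ne
    have k2 := cross p r q (by simp) (by simp) (by simp) hpr.ne hpq.ne hqr.ne'
    have k3 := cross q r p (by simp) (by simp) (by simp) hqr.ne hpq.ne' hpr.ne'
    have k4 := cross p q s (by simp) (by simp) (by simp) hpq.ne hps.ne hqs.ne
    have k5 := cross p r s (by simp) (by simp) (by simp) hpr.ne hps.ne hrs.ne
    have k6 := cross q r s (by simp) (by simp) (by simp) hqr.ne hqs.ne hrs.ne
    have l1 := k1 x y hxy
    have l2 := k2 x y hxy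
    have l3 := k3 x y hxy
    have l4 := k4 x y hxy
    have l5 := k5 x y hxy
    have l6 := k6 x y hxy
    have m1 := k1 y x hxy.symm
    have m2 := k2 y x hxy.symm
    have m3 := k3 y x hxy.symm
    have m4 := k4 y x hxy.symm
    have m5 := k5 y x hxy.symm
    have m6 := k6 y x hxy.symm
    clear k1 k2 k3 k4 k5 k6 hs1 hs2 hs3 hs4 hs5 cross pair c irr e1 hfA
    grind
  obtain ⟨fX, hfX⟩ := exists_two_col G X (by
      intro x y z hx hy hz hxy hyz
      have s1 := same x y hxy (Or.inl ⟨hx, hy⟩)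
      have s2 := same y z hyz (Or.inl ⟨hy, hz⟩)
      simp only [X] at hx hy hz
      have k1 := pair p q r s (by simp) (by simp) (by simp) (by simp) hpq hrs x y z hxy hyz
      have k2 := pair p r q s (by simp) (by simp) (by simp) (by simp) hpr hqs x y z hxy hyz
      have k3 := pair q r p s (by simp) (by simp) (by simp) (by simp) hqr hps x y z hxy hyz
      clear hs1 hs2 hs3 hs4 hs5 cross pair c irr hfA same
      grind)
  obtain ⟨fY, hfY⟩ := exists_two_col G Y (by
      intro x y z hx hy hz hxy hyz
      have s1 := same x y hxy (Or.inr ⟨hx, hy⟩)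
      have s2 := same y z hyz (Or.inr ⟨hy, hz⟩)
      simp only [Y] at hx hy hz
      have k1 := pair r s p q (by simp) (by simp) (by simp) (by simp) hrs hpq x y z hxy hyz
      have k2 := pair q s p r (by simp) (by simp) (by simp) (by simp) hqs hpr x y z hxy hyz
      have k3 := pair p s q r (by simp) (by simp) (by simp) (by simp) hps hqr x y z hxy hyz
      clear hs1 hs2 hs3 hs4 hs5 cross pair c irr hfA same
      grind)
  let A : V → Prop := fun x => ¬ G.Adj x p ∧ ¬ G.Adj x q ∧ ¬ G.Adj x r ∧ ¬ G.Adj x s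
  let B : V → Prop := fun x => (¬ G.Adj x p ∧ G.Adj x q ∧ G.Adj x r ∧ G.Adj x s) ∨
    (G.Adj x p ∧ ¬ G.Adj x q ∧ G.Adj x r ∧ G.Adj x s) ∨
    (G.Adj x p ∧ G.Adj x q ∧ ¬ G.Adj x r ∧ G.Adj x s) ∨
    (G.Adj x p ∧ G.Adj x q ∧ G.Adj x r ∧ ¬ G.Adj x s)
  have cover : ∀ x, A x ∨ X x ∨ Y x ∨ B x := by
    intro x
    have := hs1 x
    have := hs2 x
    have := hs3 x
    have := hs4 x
    have := hs5 x
    simp only [A, X, Y, B]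
    clear hs1 hs2 hs3 hs4 hs5 cross pair c irr hfA hfX hfY same
    grind
  -- vertices outside the clique with three neighbours in it are independent
  have indep : ∀ x y, B x → B y → (x ≠ p ∧ x ≠ q ∧ x ≠ r ∧ x ≠ s) →
      (y ≠ p ∧ y ≠ q ∧ y ≠ r ∧ y ≠ s) → ¬ G.Adj x y := by
    intro x y hx hy n1 n2 hxy
    simp only [B] at hx hy
    have g := no_K5 hK5 x y
    have g1 := g q r s hxy
    have g2 := g p r s hxy
    have g3 := g p q s hxy
    have g4 := g p q r hxy
    have k1 := cross p q r (by simp) (by simp) (by simp) hpq.ne hpr.ne hqr.ne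
    have k2 := cross p r q (by simp) (by simp) (by simp) hpr.ne hpq.ne hqr.ne'
    have k3 := cross p s q (by simp) (by simp) (by simp) hps.ne hpq.ne hqs.ne'
    have k4 := cross q r p (by simp) (by simp) (by simp) hqr.ne hpq.ne' hpr.ne'
    have k5 := cross q s p (by simp) (by simp) (by simp) hqs.ne hpq.ne' hps.ne'
    have k6 := cross r s p (by simp) (by simp) (by simp) hrs.ne hpr.ne' hps.ne'
    have l1 := k1 x y hxy
    have l2 := k2 x y hxy
    have l3 := k3 x y hxy
    have l4 := k4 x y hxy
    have l5 := k5 x y hxy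
    have l6 := k6 x y hxy
    have m1 := k1 y x hxy.symm
    have m2 := k2 y x hxy.symm
    have m3 := k3 y x hxy.symm
    have m4 := k4 y x hxy.symm
    have m5 := k5 y x hxy.symm
    have m6 := k6 y x hxy.symm
    clear k1 k2 k3 k4 k5 k6 hs1 hs2 hs3 hs4 hs5 cross pair c irr hfA hfX hfY same g cover
    grind
  have nX : ∀ x, X x → ¬ G.Adj x s := fun x hx => hx.1
  have nA : ∀ x, A x → ¬ G.Adj x p ∧ ¬ G.Adj x q := fun x hx => ⟨hx.1, hx.2.1⟩
  have hfA' : ∀ x y, A x → A y → G.Adj x y → fA x ≠ fA y := hfA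
  clear_value A B X Y
  clear hs1 hs2 hs3 hs4 hs5 cross pair same hfA
  let col : V → Fin 8 := fun x =>
    if x = p then 5 else if x = q then 6 else if x = r then 7 else if x = s then 1
    else if A x then (if fA x then 5 else 6)
    else if X x then (if fX x then 1 else 2)
    else if Y x then (if fY x then 3 else 4)
    else 0
  have spec : ∀ x, (x = p ∧ col x = 5) ∨ (x = q ∧ col x = 6) ∨ (x = r ∧ col x = 7) ∨
      (x = s ∧ col x = 1) ∨ ((A x ∧ fA x = true) ∧ col x = 5) ∨ ((A x ∧ fA x = false) ∧ col x = 6) ∨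
      ((X x ∧ fX x = true) ∧ col x = 1) ∨ ((X x ∧ fX x = false) ∧ col x = 2) ∨
      ((Y x ∧ fY x = true) ∧ col x = 3) ∨ ((Y x ∧ fY x = false) ∧ col x = 4) ∨
      ((B x ∧ x ≠ p ∧ x ≠ q ∧ x ≠ r ∧ x ≠ s) ∧ col x = 0) := by
    intro x
    have c1 := cover x
    clear cover indep hfA' hfX hfY nX nA c irr
    simp only [col]
    split_ifs <;> simp_all
  have hcol : ∀ x y, G.Adj x y → col x ≠ col y := by
    intro x y hxy
    have c1 := cover x
    have c2 := cover y
    have i1 := indep x y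
    have a1 := hfA' x y
    have a2 := hfX x y
    have a3 := hfY x y
    have x1 := nX x
    have x2 := nX y
    have y1 := nA x
    have y2 := nA y
    have hne := hxy.ne
    have cc := hxy.symm
    clear cover indep hfA' hfX hfY nX nA
    have s1 := spec x
    have s2 := spec y
    clear_value col
    clear spec
    intro heq
    have pq := hpq.ne
    have pr := hpr.ne
    rcases s1 with s1 | s1 | s1 | s1 | s1 | s1 | s1 | s1 | s1 | s1 | s1 <;>
    rcases s2 with s2 | s2 | s2 | s2 | s2 | s2 | s2 | s2 | s2 | s2 | s2 <;>
    first
    | (exfalso; rw [s1.2, s2.2] at heq; revert heq; decide)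
    | grind
  have : G.Colorable 8 := ⟨SimpleGraph.Coloring.mk col (fun {x y} h => hcol x y h)⟩
  exact_mod_cast this.chromaticNumber_le
end
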